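/- Let (H,A) be a compatible weak matched pair of weak Hopf algebras satisfying conditions (7) and (8), so that A♯♯H is a weak Hopf algebra. Let α be a left integral in A and t a left integral in H such that (h·α)εs((t₁)¹(t₂·1_A)) ⊗ (t₁)⁰ = (h⁰·1_A)εs(h¹)·α·εs((t₁)¹(t₂·1_A)) ⊗ (t₁)⁰ in A⊗H for all h ∈ H. Then α♯♯t is a left integral in A♯♯H: (x♯♯h)(α♯♯t) = εt(x♯♯h)·(α♯♯t) for all x ∈ A, h ∈ H, where εt is computed in the weak Hopf algebra A♯♯H. -/

import Mathlib

open TensorProduct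

noncomputable section

namespace WeakSmash

variable (k : Type*) [Field k]

/-- A weak bialgebra structure on the `k`-algebra `H`. -/
structure WeakBialgebra (H : Type*) [Ring H] [Algebra k H] where
  comul : H →ₗ[k] H ⊗[k] H
  counit : H →ₗ[k] k
  coassoc : ∀ h : H,
    (TensorProduct.assoc k H H H) ((LinearMap.rTensor H comul) (comul h)) =
      (LinearMap.lTensor H comul) (comul h)
  counit_comul : ∀ h : H,
    (TensorProduct.lid k H) ((LinearMap.rTensor H counit) (comul h)) = h
  comul_counit : ∀ h : H,
    (TensorProduct.rid k H) ((LinearMap.lTensor H counit) (comul h)) = h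
  comul_mul : ∀ h g : H, comul (h * g) = comul h * comul g
  counit_weak : ∀ h g l : H,
    counit (h * g * l) =
      LinearMap.mul' k k
        ((TensorProduct.map (counit ∘ₗ LinearMap.mulLeft k h)
            (counit ∘ₗ LinearMap.mulRight k l)) (comul g))
  counit_weak' : ∀ h g l : H,
    counit (h * g * l) =
      LinearMap.mul' k k
        ((TensorProduct.map (counit ∘ₗ LinearMap.mulLeft k h)
            (counit ∘ₗ LinearMap.mulRight k l)) ((TensorProduct.comm k H H) (comul g)))
  comul_one_left :
    ((TensorProduct.assoc k H H H) (comul 1 ⊗ₜ[k] (1 : H))) * ((1 : H) ⊗ₜ[k] comul 1) =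
      (LinearMap.lTensor H comul) (comul 1)
  comul_one_right :
    ((1 : H) ⊗ₜ[k] comul 1) * ((TensorProduct.assoc k H H H) (comul 1 ⊗ₜ[k] (1 : H))) =
      (LinearMap.lTensor H comul) (comul 1)

variable {k}

namespace WeakBialgebra

variable {H : Type*} [Ring H] [Algebra k H]

/-- The target counital map `εt h = ε(1₁ h) 1₂`. -/
def εt (W : WeakBialgebra k H) : H →ₗ[k] H :=
  (TensorProduct.lid k H).toLinearMap ∘ₗ LinearMap.rTensor H W.counit ∘ₗ
    LinearMap.mulLeft k (W.comul 1) ∘ₗ (TensorProduct.mk k H H).flip 1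

/-- The source counital map `εs h = 1₁ ε(h 1₂)`. -/
def εs (W : WeakBialgebra k H) : H →ₗ[k] H :=
  (TensorProduct.rid k H).toLinearMap ∘ₗ LinearMap.lTensor H W.counit ∘ₗ
    LinearMap.mulRight k (W.comul 1) ∘ₗ TensorProduct.mk k H H 1

/-- Cocommutativity of a weak bialgebra. -/
def Cocomm (W : WeakBialgebra k H) : Prop :=
  ∀ h : H, (TensorProduct.comm k H H) (W.comul h) = W.comul h

/-- `S` is an antipode for `W`, making it a weak Hopf algebra. -/
structure IsAntipode (W : WeakBialgebra k H) (S : H →ₗ[k] H) : Prop where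
  mul_antipode : ∀ h : H,
    LinearMap.mul' k H ((LinearMap.lTensor H S) (W.comul h)) = W.εt h
  antipode_mul : ∀ h : H,
    LinearMap.mul' k H ((LinearMap.rTensor H S) (W.comul h)) = W.εs h
  antipode_mid : ∀ h : H,
    LinearMap.mul' k H
      ((TensorProduct.map S (LinearMap.mul' k H ∘ₗ LinearMap.lTensor H S))
        ((LinearMap.lTensor H W.comul) (W.comul h))) = S h

/-- `α` is a left integral: `h α = εt(h) α`. -/
def IsLeftIntegral (W : WeakBialgebra k H) (α : H) : Prop :=
  ∀ h : H, h * α = W.εt h * α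

end WeakBialgebra

section MatchedPair

variable (k)
variable {H A : Type*} [Ring H] [Algebra k H] [Ring A] [Algebra k A]

/-- `A` is a left `H`-module algebra via the action `act`. -/
structure IsModuleAlgebra (WH : WeakBialgebra k H) (act : H →ₗ[k] A →ₗ[k] A) : Prop where
  one_act : ∀ a : A, act 1 a = a
  act_mul : ∀ (h : H) (a b : A),
    act h (a * b) =
      LinearMap.mul' k A ((TensorProduct.map (act.flip a) (act.flip b)) (WH.comul h))
  act_act : ∀ (h g : H) (a : A), act h (act g a) = act (h * g) a
  act_unit : ∀ h : H, act h 1 = act (WH.εt h) 1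

/-- The map `h ↦ ε(h⁰) h¹`. -/
def coactCounit (WH : WeakBialgebra k H) (coact : H →ₗ[k] H ⊗[k] A) : H →ₗ[k] A :=
  (TensorProduct.lid k A).toLinearMap ∘ₗ LinearMap.rTensor A WH.counit ∘ₗ coact

/-- `H` is a right `A`-comodule coalgebra via the coaction `coact`. -/
structure IsComoduleCoalgebra (WH : WeakBialgebra k H) (WA : WeakBialgebra k A)
    (coact : H →ₗ[k] H ⊗[k] A) : Prop where
  counit_coact : ∀ h : H,
    (TensorProduct.rid k H) ((LinearMap.lTensor H WA.counit) (coact h)) = h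
  comul_coact : ∀ h : H,
    (LinearMap.rTensor A WH.comul) (coact h) =
      (LinearMap.lTensor (H ⊗[k] H) (LinearMap.mul' k A))
        ((TensorProduct.tensorTensorTensorComm k H A H A)
          ((TensorProduct.map coact coact) (WH.comul h)))
  coact_coact : ∀ h : H,
    (TensorProduct.assoc k H A A) ((LinearMap.rTensor A coact) (coact h)) =
      (LinearMap.lTensor H WA.comul) (coact h)
  coact_counit : ∀ h : H,
    coactCounit k WH coact h = WA.εs (coactCounit k WH coact h)

/-- The map `(h₁ ⊗ h₂) ⊗ (x₁ ⊗ x₂) ↦ (h₁⁰ · x₁) ⊗ (h₁¹ (h₂ · x₂))`. -/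
def pairMapA (act : H →ₗ[k] A →ₗ[k] A) (coact : H →ₗ[k] H ⊗[k] A) :
    (H ⊗[k] H) ⊗[k] (A ⊗[k] A) →ₗ[k] A ⊗[k] A :=
  LinearMap.lTensor A (LinearMap.mul' k A) ∘ₗ
  (TensorProduct.assoc k A A A).toLinearMap ∘ₗ
  LinearMap.rTensor A
    (LinearMap.rTensor A (TensorProduct.lift act) ∘ₗ
      (TensorProduct.assoc k H A A).symm.toLinearMap ∘ₗ
      LinearMap.lTensor H (TensorProduct.comm k A A).toLinearMap ∘ₗ
      (TensorProduct.assoc k H A A).toLinearMap) ∘ₗ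
  TensorProduct.map (LinearMap.rTensor A coact) (TensorProduct.lift act) ∘ₗ
  (TensorProduct.tensorTensorTensorComm k H H A A).toLinearMap

/-- The map `(h₁ ⊗ h₂) ⊗ (g⁰ ⊗ g¹) ↦ (h₁⁰ g⁰) ⊗ (h₁¹ (h₂ · g¹))`. -/
def pairMapH (act : H →ₗ[k] A →ₗ[k] A) (coact : H →ₗ[k] H ⊗[k] A) :
    (H ⊗[k] H) ⊗[k] (H ⊗[k] A) →ₗ[k] H ⊗[k] A :=
  LinearMap.lTensor H (LinearMap.mul' k A) ∘ₗ
  (TensorProduct.assoc k H A A).toLinearMap ∘ₗ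
  LinearMap.rTensor A
    (LinearMap.rTensor A (LinearMap.mul' k H) ∘ₗ
      (TensorProduct.assoc k H H A).symm.toLinearMap ∘ₗ
      LinearMap.lTensor H (TensorProduct.comm k A H).toLinearMap ∘ₗ
      (TensorProduct.assoc k H A H).toLinearMap) ∘ₗ
  TensorProduct.map (LinearMap.rTensor H coact) (TensorProduct.lift act) ∘ₗ
  (TensorProduct.tensorTensorTensorComm k H H H A).toLinearMap

/-- The iterated comultiplication `h ↦ h₁ ⊗ (h₂ ⊗ h₃)`. -/
def twoComul (WH : WeakBialgebra k H) : H →ₗ[k] H ⊗[k] (H ⊗[k] H) :=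
  LinearMap.lTensor H WH.comul ∘ₗ WH.comul

/-- The iterated comultiplication `h ↦ h₁ ⊗ (h₂ ⊗ (h₃ ⊗ h₄))`. -/
def threeComul (WH : WeakBialgebra k H) : H →ₗ[k] H ⊗[k] (H ⊗[k] (H ⊗[k] H)) :=
  LinearMap.lTensor H (LinearMap.lTensor H WH.comul) ∘ₗ LinearMap.lTensor H WH.comul ∘ₗ WH.comul

/-- Left-hand side of the matched pair condition (iii):
`(h₁·x)₁ ⊗ (h₂ g)⁰ ⊗ (h₁·x)₂ (h₂ g)¹`. -/
def mpLHS (WH : WeakBialgebra k H) (WA : WeakBialgebra k A)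
    (act : H →ₗ[k] A →ₗ[k] A) (coact : H →ₗ[k] H ⊗[k] A) (h g : H) (x : A) :
    (A ⊗[k] H) ⊗[k] A :=
  LinearMap.lTensor (A ⊗[k] H) (LinearMap.mul' k A)
    ((TensorProduct.tensorTensorTensorComm k A A H A)
      ((TensorProduct.map (WA.comul ∘ₗ act.flip x) (coact ∘ₗ LinearMap.mulRight k g))
        (WH.comul h)))

/-- Right-hand side of the matched pair condition (iii):
`(h₁⁰ · x₁) ⊗ (h₃⁰ g⁰) ⊗ (h₁¹ (h₂ · x₂) h₃¹ (h₄ · g¹))`. -/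
def mpRHS (WH : WeakBialgebra k H) (WA : WeakBialgebra k A)
    (act : H →ₗ[k] A →ₗ[k] A) (coact : H →ₗ[k] H ⊗[k] A) (h g : H) (x : A) :
    (A ⊗[k] H) ⊗[k] A :=
  LinearMap.lTensor (A ⊗[k] H) (LinearMap.mul' k A)
    ((TensorProduct.tensorTensorTensorComm k A A H A)
      ((TensorProduct.map
          (pairMapA k act coact ∘ₗ
            (TensorProduct.mk k (H ⊗[k] H) (A ⊗[k] A)).flip (WA.comul x))
          (pairMapH k act coact ∘ₗ
            (TensorProduct.mk k (H ⊗[k] H) (H ⊗[k] A)).flip (coact g)))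
        ((TensorProduct.assoc k H H (H ⊗[k] H)).symm (threeComul k WH h))))

/-- `(H, A)` is a weak matched pair. -/
structure IsWeakMatchedPair (WH : WeakBialgebra k H) (WA : WeakBialgebra k A)
    (act : H →ₗ[k] A →ₗ[k] A) (coact : H →ₗ[k] H ⊗[k] A) : Prop where
  moduleAlgebra : IsModuleAlgebra k WH act
  comoduleCoalgebra : IsComoduleCoalgebra k WH WA coact
  cond3 : ∀ (h g : H) (x : A),
    mpLHS k WH WA act coact h g x = mpRHS k WH WA act coact h g x
  cond4 : ∀ (h : H) (x : A), WA.εs (act h x) = WA.εs (act h 1) * WA.εs x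
  cond5 :
    (LinearMap.rTensor H coact) (WH.comul 1) =
      (TensorProduct.map (LinearMap.lTensor H (coactCounit k WH coact))
          (LinearMap.mul' k H))
        ((TensorProduct.tensorTensorTensorComm k H H H H)
          (WH.comul 1 ⊗ₜ[k] WH.comul 1))

/-- `(H, A)` is a compatible (abelian) weak matched pair. -/
structure IsCompatiblePair (WH : WeakBialgebra k H) (WA : WeakBialgebra k A)
    (act : H →ₗ[k] A →ₗ[k] A) (coact : H →ₗ[k] H ⊗[k] A) : Prop where
  pair : IsWeakMatchedPair k WH WA act coact
  cocomm : WH.Cocomm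
  comm : ∀ a b : A, a * b = b * a
  compat1 : ∀ h : H,
    act h 1 =
      (TensorProduct.rid k A)
        ((TensorProduct.map (TensorProduct.lift act)
            (WA.counit ∘ₗ TensorProduct.lift act))
          ((TensorProduct.tensorTensorTensorComm k H H A A)
            (WH.comul h ⊗ₜ[k] WA.comul 1)))
  compat2 : ∀ h g : H,
    (TensorProduct.map (act h) (act g)) (WA.comul 1) =
      (TensorProduct.map (LinearMap.mulLeft k (act h 1))
        (LinearMap.mulLeft k (act g 1))) (WA.comul 1)

/-- The smash product multiplication on `A ⊗ H`:
`(x ⊗ h) (y ⊗ g) = x (h₁ · y) ⊗ h₂ g`. -/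
def smashMul (WH : WeakBialgebra k H) (act : H →ₗ[k] A →ₗ[k] A) :
    (A ⊗[k] H) ⊗[k] (A ⊗[k] H) →ₗ[k] A ⊗[k] H :=
  LinearMap.rTensor H (LinearMap.mul' k A) ∘ₗ
  (TensorProduct.assoc k A A H).symm.toLinearMap ∘ₗ
  LinearMap.lTensor A
    (TensorProduct.map (TensorProduct.lift act) (LinearMap.mul' k H) ∘ₗ
      (TensorProduct.tensorTensorTensorComm k H H A H).toLinearMap) ∘ₗ
  (TensorProduct.assoc k A (H ⊗[k] H) (A ⊗[k] H)).toLinearMap ∘ₗ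
  LinearMap.rTensor (A ⊗[k] H) (LinearMap.lTensor A WH.comul)

/-- The smash coproduct on `A ⊗ H`:
`Δ(x ⊗ h) = (x₁ ⊗ h₁⁰) ⊗ (x₂ h₁¹ ⊗ h₂)`. -/
def smashComul (WH : WeakBialgebra k H) (WA : WeakBialgebra k A)
    (coact : H →ₗ[k] H ⊗[k] A) :
    A ⊗[k] H →ₗ[k] (A ⊗[k] H) ⊗[k] (A ⊗[k] H) :=
  (TensorProduct.assoc k (A ⊗[k] H) A H).toLinearMap ∘ₗ
  LinearMap.rTensor H (LinearMap.lTensor (A ⊗[k] H) (LinearMap.mul' k A)) ∘ₗ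
  LinearMap.rTensor H (TensorProduct.tensorTensorTensorComm k A A H A).toLinearMap ∘ₗ
  (TensorProduct.assoc k (A ⊗[k] A) (H ⊗[k] A) H).symm.toLinearMap ∘ₗ
  LinearMap.lTensor (A ⊗[k] A) (LinearMap.rTensor H coact) ∘ₗ
  TensorProduct.map WA.comul WH.comul

/-- The smash counit `ε(x ⊗ h) = ε(x) ε(h)`. -/
def smashCounit (WH : WeakBialgebra k H) (WA : WeakBialgebra k A) :
    A ⊗[k] H →ₗ[k] k :=
  LinearMap.mul' k k ∘ₗ TensorProduct.map WA.counit WH.counit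

/-- The projection `u ↦ u (1_A # 1_H)` onto `A ♯ H`. -/
def projUnder (WH : WeakBialgebra k H) (act : H →ₗ[k] A →ₗ[k] A) :
    A ⊗[k] H →ₗ[k] A ⊗[k] H :=
  smashMul k WH act ∘ₗ
    (TensorProduct.mk k (A ⊗[k] H) (A ⊗[k] H)).flip ((1 : A) ⊗ₜ[k] (1 : H))

/-- The projection `u ↦ (id ⊗ ε) Δ(u)` onto `overline(A # H)`. -/
def projBar (WH : WeakBialgebra k H) (WA : WeakBialgebra k A)
    (coact : H →ₗ[k] H ⊗[k] A) : A ⊗[k] H →ₗ[k] A ⊗[k] H :=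
  (TensorProduct.rid k (A ⊗[k] H)).toLinearMap ∘ₗ
    LinearMap.lTensor (A ⊗[k] H) (smashCounit k WH WA) ∘ₗ smashComul k WH WA coact

/-- The projection onto `A ♯♯ H`, i.e. `u ↦ (id ⊗ ε) Δ (u (1#1))`. -/
def projBoth (WH : WeakBialgebra k H) (WA : WeakBialgebra k A)
    (act : H →ₗ[k] A →ₗ[k] A) (coact : H →ₗ[k] H ⊗[k] A) :
    A ⊗[k] H →ₗ[k] A ⊗[k] H :=
  projBar k WH WA coact ∘ₗ projUnder k WH act

/-- Componentwise smash multiplication on `(A⊗H) ⊗ (A⊗H)`. -/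
def smashMul2 (WH : WeakBialgebra k H) (act : H →ₗ[k] A →ₗ[k] A) :
    ((A ⊗[k] H) ⊗[k] (A ⊗[k] H)) ⊗[k] ((A ⊗[k] H) ⊗[k] (A ⊗[k] H)) →ₗ[k]
      (A ⊗[k] H) ⊗[k] (A ⊗[k] H) :=
  TensorProduct.map (smashMul k WH act) (smashMul k WH act) ∘ₗ
    (TensorProduct.tensorTensorTensorComm k (A ⊗[k] H) (A ⊗[k] H)
      (A ⊗[k] H) (A ⊗[k] H)).toLinearMap

/-- Componentwise smash multiplication on threefold tensors. -/
def smashMul3 (WH : WeakBialgebra k H) (act : H →ₗ[k] A →ₗ[k] A) :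
    ((A ⊗[k] H) ⊗[k] ((A ⊗[k] H) ⊗[k] (A ⊗[k] H))) ⊗[k]
      ((A ⊗[k] H) ⊗[k] ((A ⊗[k] H) ⊗[k] (A ⊗[k] H))) →ₗ[k]
      (A ⊗[k] H) ⊗[k] ((A ⊗[k] H) ⊗[k] (A ⊗[k] H)) :=
  TensorProduct.map (smashMul k WH act) (smashMul2 k WH act) ∘ₗ
    (TensorProduct.tensorTensorTensorComm k (A ⊗[k] H)
      ((A ⊗[k] H) ⊗[k] (A ⊗[k] H)) (A ⊗[k] H)
      ((A ⊗[k] H) ⊗[k] (A ⊗[k] H))).toLinearMap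

/-- The unit element `1_A ♯♯ 1_H` of `A ♯♯ H`. -/
def smashOne (WH : WeakBialgebra k H) (WA : WeakBialgebra k A)
    (act : H →ₗ[k] A →ₗ[k] A) (coact : H →ₗ[k] H ⊗[k] A) : A ⊗[k] H :=
  projBoth k WH WA act coact ((1 : A) ⊗ₜ[k] (1 : H))

/-- The map `εt` of the weak bialgebra `A ♯♯ H`: `u ↦ ε(e₁ u) e₂` where `e = 1_A ♯♯ 1_H`. -/
def smashEpsT (WH : WeakBialgebra k H) (WA : WeakBialgebra k A)
    (act : H →ₗ[k] A →ₗ[k] A) (coact : H →ₗ[k] H ⊗[k] A) (u : A ⊗[k] H) :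
    A ⊗[k] H :=
  (TensorProduct.lid k (A ⊗[k] H))
    ((LinearMap.rTensor (A ⊗[k] H)
        (smashCounit k WH WA ∘ₗ smashMul k WH act ∘ₗ
          (TensorProduct.mk k (A ⊗[k] H) (A ⊗[k] H)).flip u))
      (smashComul k WH WA coact (smashOne k WH WA act coact)))

/-- The map `εs` of the weak bialgebra `A ♯♯ H`: `u ↦ e₁ ε(u e₂)` where `e = 1_A ♯♯ 1_H`. -/
def smashEpsS (WH : WeakBialgebra k H) (WA : WeakBialgebra k A)
    (act : H →ₗ[k] A →ₗ[k] A) (coact : H →ₗ[k] H ⊗[k] A) (u : A ⊗[k] H) :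
    A ⊗[k] H :=
  (TensorProduct.rid k (A ⊗[k] H))
    ((LinearMap.lTensor (A ⊗[k] H)
        (smashCounit k WH WA ∘ₗ smashMul k WH act ∘ₗ
          TensorProduct.mk k (A ⊗[k] H) (A ⊗[k] H) u))
      (smashComul k WH WA coact (smashOne k WH WA act coact)))

/-- The antipode of `A ♯♯ H`:
`S(x ⊗ h) = (1_A ♯♯ S_H(h⁰)) ((S_A(x h¹)) ♯♯ 1_H)`. -/
def smashAntipode (WH : WeakBialgebra k H) (WA : WeakBialgebra k A)
    (act : H →ₗ[k] A →ₗ[k] A) (coact : H →ₗ[k] H ⊗[k] A)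
    (SH : H →ₗ[k] H) (SA : A →ₗ[k] A) : A ⊗[k] H →ₗ[k] A ⊗[k] H :=
  smashMul k WH act ∘ₗ
  TensorProduct.map
    (projBoth k WH WA act coact ∘ₗ TensorProduct.mk k A H 1)
    (projBoth k WH WA act coact ∘ₗ (TensorProduct.mk k A H).flip 1) ∘ₗ
  (TensorProduct.comm k A H).toLinearMap ∘ₗ
  TensorProduct.map (SA ∘ₗ LinearMap.mul' k A) SH ∘ₗ
  (TensorProduct.assoc k A A H).symm.toLinearMap ∘ₗ
  LinearMap.lTensor A ((TensorProduct.comm k H A).toLinearMap ∘ₗ coact)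

/-- LHS of condition (7): `(1_{H1} h⁰ · 1_A) ⊗ S_A(h¹) εs(1_{H2}¹) ⊗ 1_{H2}⁰`. -/
def cond7LHS (WH : WeakBialgebra k H) (WA : WeakBialgebra k A)
    (act : H →ₗ[k] A →ₗ[k] A) (coact : H →ₗ[k] H ⊗[k] A)
    (SA : A →ₗ[k] A) (h : H) : (A ⊗[k] A) ⊗[k] H :=
  (TensorProduct.assoc k A A H).symm
    ((TensorProduct.map
        (act.flip 1 ∘ₗ LinearMap.mul' k H)
        ((TensorProduct.comm k H A).toLinearMap ∘ₗ
          LinearMap.lTensor H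
            (LinearMap.mul' k A ∘ₗ TensorProduct.map SA WA.εs ∘ₗ
              (TensorProduct.comm k A A).toLinearMap) ∘ₗ
          (TensorProduct.assoc k H A A).toLinearMap ∘ₗ
          LinearMap.rTensor A coact))
      ((TensorProduct.tensorTensorTensorComm k H H H A)
        (WH.comul 1 ⊗ₜ[k] coact h)))

/-- RHS of condition (7):
`εt(1_{H1}⁰ h⁰ · 1_A) ⊗ εt(h¹) εs(1_{H2}¹) 1_{H1}¹ ⊗ 1_{H2}⁰`. -/
def cond7RHS (WH : WeakBialgebra k H) (WA : WeakBialgebra k A)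
    (act : H →ₗ[k] A →ₗ[k] A) (coact : H →ₗ[k] H ⊗[k] A) (h : H) :
    (A ⊗[k] A) ⊗[k] H :=
  (TensorProduct.assoc k A A H).symm
   ((LinearMap.lTensor A (TensorProduct.comm k H A).toLinearMap)
    ((TensorProduct.assoc k A H A)
     ((LinearMap.lTensor (A ⊗[k] H)
        (LinearMap.mul' k A ∘ₗ (TensorProduct.comm k A A).toLinearMap))
      ((TensorProduct.tensorTensorTensorComm k A A H A)
       ((LinearMap.lTensor (A ⊗[k] A) (TensorProduct.comm k A H).toLinearMap)
        ((TensorProduct.map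
            (LinearMap.rTensor A (WA.εt ∘ₗ act.flip 1 ∘ₗ LinearMap.mul' k H) ∘ₗ
              (TensorProduct.assoc k H H A).symm.toLinearMap ∘ₗ
              LinearMap.lTensor H (TensorProduct.comm k A H).toLinearMap ∘ₗ
              (TensorProduct.assoc k H A H).toLinearMap)
            (LinearMap.rTensor H
                (LinearMap.mul' k A ∘ₗ (TensorProduct.comm k A A).toLinearMap ∘ₗ
                  TensorProduct.map WA.εs WA.εt) ∘ₗ
              (TensorProduct.assoc k A A H).symm.toLinearMap ∘ₗ
              LinearMap.lTensor A (TensorProduct.comm k H A).toLinearMap ∘ₗ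
              (TensorProduct.assoc k A H A).toLinearMap ∘ₗ
              LinearMap.rTensor A (TensorProduct.comm k H A).toLinearMap))
          ((TensorProduct.tensorTensorTensorComm k (H ⊗[k] A) (H ⊗[k] A) H A)
            (((TensorProduct.map coact coact) (WH.comul 1)) ⊗ₜ[k] coact h))))))))

/-- LHS of condition (8):
`εs(h₁¹ h₂¹) (S_H(h₁⁰) · 1_A) ⊗ S_H(h₂⁰) h₃`. -/
def cond8LHS (WH : WeakBialgebra k H) (WA : WeakBialgebra k A)
    (act : H →ₗ[k] A →ₗ[k] A) (coact : H →ₗ[k] H ⊗[k] A)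
    (SH : H →ₗ[k] H) (h : H) : A ⊗[k] H :=
  LinearMap.rTensor H (LinearMap.mul' k A)
   ((TensorProduct.assoc k A A H).symm
    ((TensorProduct.map
        (WA.εs ∘ₗ LinearMap.mul' k A)
        (TensorProduct.map (act.flip 1 ∘ₗ SH)
          (LinearMap.mul' k H ∘ₗ LinearMap.rTensor H SH)))
      ((TensorProduct.tensorTensorTensorComm k A H A (H ⊗[k] H))
        ((TensorProduct.map (TensorProduct.comm k H A).toLinearMap
            ((TensorProduct.assoc k A H H).toLinearMap ∘ₗ
              LinearMap.rTensor H (TensorProduct.comm k H A).toLinearMap))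
          ((TensorProduct.map coact (LinearMap.rTensor H coact))
            (twoComul k WH h))))))

/-- RHS of condition (8):
`εs(h¹ 1_{H2}¹) εs(h⁰ 1_{H1} · 1_A) ⊗ 1_{H2}⁰`. -/
def cond8RHS (WH : WeakBialgebra k H) (WA : WeakBialgebra k A)
    (act : H →ₗ[k] A →ₗ[k] A) (coact : H →ₗ[k] H ⊗[k] A) (h : H) :
    A ⊗[k] H :=
  LinearMap.rTensor H (LinearMap.mul' k A ∘ₗ (TensorProduct.comm k A A).toLinearMap)
   ((TensorProduct.assoc k A A H).symm
    ((TensorProduct.map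
        (WA.εs ∘ₗ act.flip 1 ∘ₗ LinearMap.mul' k H)
        (LinearMap.rTensor H (WA.εs ∘ₗ LinearMap.mul' k A) ∘ₗ
          (TensorProduct.assoc k A A H).symm.toLinearMap ∘ₗ
          LinearMap.lTensor A (TensorProduct.comm k H A).toLinearMap))
      ((TensorProduct.tensorTensorTensorComm k H A H (H ⊗[k] A))
        (coact h ⊗ₜ[k] (LinearMap.lTensor H coact) (WH.comul 1)))))

/-- The element `εs(t₁¹ (t₂ · 1_A)) ⊗ t₁⁰` of `A ⊗ H`. -/
def integralWitness (WH : WeakBialgebra k H) (WA : WeakBialgebra k A)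
    (act : H →ₗ[k] A →ₗ[k] A) (coact : H →ₗ[k] H ⊗[k] A) (t : H) :
    A ⊗[k] H :=
  (TensorProduct.comm k H A)
    ((LinearMap.lTensor H (WA.εs ∘ₗ LinearMap.mul' k A))
      ((TensorProduct.assoc k H A A)
        ((LinearMap.rTensor A coact)
          ((LinearMap.lTensor H (act.flip 1)) (WH.comul t)))))

end MatchedPair

end WeakSmash

namespace WeakSmash

namespace WeakBialgebra

variable {k : Type*} [Field k] {H : Type*} [Ring H] [Algebra k H]
variable {B : Type*} [Ring B] [Algebra k B]

/-- The convolution product of two linear maps. -/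
def conv (W : WeakBialgebra k H) (f g : H →ₗ[k] B) : H →ₗ[k] B :=
  LinearMap.mul' k B ∘ₗ TensorProduct.map f g ∘ₗ W.comul

/-- The unit of the convolution product. -/
def convOne (W : WeakBialgebra k H) (B : Type*) [Ring B] [Algebra k B] : H →ₗ[k] B :=
  Algebra.linearMap k B ∘ₗ W.counit

theorem conv_apply (W : WeakBialgebra k H) (f g : H →ₗ[k] B) (h : H) :
    W.conv f g h = LinearMap.mul' k B (TensorProduct.map f g (W.comul h)) := rfl

theorem conv_assoc (W : WeakBialgebra k H) (f g l : H →ₗ[k] B) :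
    W.conv (W.conv f g) l = W.conv f (W.conv g l) := by
  ext h
  have key (X : (H ⊗[k] H) ⊗[k] H) :
      LinearMap.mul' k B (TensorProduct.map (LinearMap.mul' k B ∘ₗ TensorProduct.map f g) l X) =
        LinearMap.mul' k B (TensorProduct.map f (LinearMap.mul' k B ∘ₗ TensorProduct.map g l)
          (TensorProduct.assoc k H H H X)) := by
    refine LinearMap.congr_fun (f := LinearMap.mul' k B ∘ₗ
      (TensorProduct.map (LinearMap.mul' k B ∘ₗ TensorProduct.map f g) l)) (g := LinearMap.mul' k B ∘ₗ
      (TensorProduct.map f (LinearMap.mul' k B ∘ₗ TensorProduct.map g l)) ∘ₗ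
          (TensorProduct.assoc k H H H).toLinearMap) ?_ X
    ext; simp [mul_assoc]
  have := key (W.comul.rTensor H (W.comul h))
  rw [W.coassoc] at this
  simpa [conv, LinearMap.rTensor, LinearMap.lTensor, TensorProduct.map_map,
    LinearMap.comp_assoc] using this

theorem convOne_conv (W : WeakBialgebra k H) (f : H →ₗ[k] B) : W.conv (W.convOne B) f = f := by
  ext h
  have key (X : H ⊗[k] H) : LinearMap.mul' k B (TensorProduct.map (W.convOne B) f X) =
      f (TensorProduct.lid k H (LinearMap.rTensor H W.counit X)) := by
    induction X using TensorProduct.induction_on with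
    | zero => simp
    | tmul a b => simp [convOne, ← Algebra.smul_def]
    | add a b ha hb => simp [map_add, ha, hb]
  rw [conv_apply, key, W.counit_comul]

theorem conv_comm (W : WeakBialgebra k H) (hW : W.Cocomm) {f g : H →ₗ[k] B}
    (hfg : ∀ a b, f a * g b = g b * f a) : W.conv f g = W.conv g f := by
  ext h
  have key (X : H ⊗[k] H) : LinearMap.mul' k B (TensorProduct.map f g X) =
      LinearMap.mul' k B (TensorProduct.map g f (TensorProduct.comm k H H X)) := by
    induction X using TensorProduct.induction_on with
    | zero => simp
    | tmul a b => simp [hfg]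
    | add a b ha hb => simp [map_add, ha, hb]
  rw [conv_apply, key, hW, conv_apply]

theorem comul_one_mul (W : WeakBialgebra k H) (h : H) : W.comul 1 * W.comul h = W.comul h := by
  rw [← W.comul_mul, one_mul]

theorem comul_mul_one (W : WeakBialgebra k H) (h : H) : W.comul h * W.comul 1 = W.comul h := by
  rw [← W.comul_mul, mul_one]

/-- `a ⊗ b ↦ ε(a h) b`. -/
def counitMulLeft (W : WeakBialgebra k H) (h : H) (M : Type*) [AddCommGroup M] [Module k M] :
    H ⊗[k] M →ₗ[k] M :=
  (TensorProduct.lid k M).toLinearMap ∘ₗ LinearMap.rTensor M (W.counit ∘ₗ LinearMap.mulRight k h)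

@[simp]
theorem counitMulLeft_tmul (W : WeakBialgebra k H) (h : H) {M : Type*} [AddCommGroup M]
    [Module k M] (a : H) (m : M) :
    W.counitMulLeft h M (a ⊗ₜ[k] m) = W.counit (a * h) • m := by
  simp [counitMulLeft]

theorem εt_eq (W : WeakBialgebra k H) (h : H) : W.εt h = W.counitMulLeft h H (W.comul 1) := by
  simp only [εt, LinearMap.comp_apply, LinearMap.flip_apply, TensorProduct.mk_apply,
    LinearMap.mulLeft_apply, LinearEquiv.coe_coe]
  induction W.comul 1 using TensorProduct.induction_on with
  | zero => simp
  | tmul a b => simp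
  | add a b ha hb => simp only [add_mul, map_add, ha, hb]

/-- `a ⊗ b ↦ ε(h b) a`. -/
def counitMulRight (W : WeakBialgebra k H) (h : H) (M : Type*) [AddCommGroup M] [Module k M] :
    M ⊗[k] H →ₗ[k] M :=
  (TensorProduct.rid k M).toLinearMap ∘ₗ LinearMap.lTensor M (W.counit ∘ₗ LinearMap.mulLeft k h)

@[simp]
theorem counitMulRight_tmul (W : WeakBialgebra k H) (h : H) {M : Type*} [AddCommGroup M]
    [Module k M] (m : M) (a : H) :
    W.counitMulRight h M (m ⊗ₜ[k] a) = W.counit (h * a) • m := by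
  simp [counitMulRight]

theorem εs_eq (W : WeakBialgebra k H) (h : H) : W.εs h = W.counitMulRight h H (W.comul 1) := by
  simp only [εs, LinearMap.comp_apply, TensorProduct.mk_apply,
    LinearMap.mulRight_apply, LinearEquiv.coe_coe]
  induction W.comul 1 using TensorProduct.induction_on with
  | zero => simp
  | tmul a b => simp
  | add a b ha hb => simp only [mul_add, map_add, ha, hb]

theorem comul_counitMulLeft (W : WeakBialgebra k H) (h : H) (X : H ⊗[k] H) :
    W.comul (W.counitMulLeft h H X) = W.counitMulLeft h (H ⊗[k] H) (W.comul.lTensor H X) := by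
  induction X using TensorProduct.induction_on with
  | zero => simp
  | tmul a b => simp
  | add a b ha hb => simp only [map_add, ha, hb]

theorem comul_εt_left (W : WeakBialgebra k H) (h : H) :
    W.comul (W.εt h) = (W.εt h ⊗ₜ[k] 1) * W.comul 1 := by
  have key (X Y : H ⊗[k] H) : W.counitMulLeft h (H ⊗[k] H)
      (TensorProduct.assoc k H H H (X ⊗ₜ[k] 1) * (1 ⊗ₜ[k] Y)) =
      (W.counitMulLeft h H X ⊗ₜ[k] 1) * Y := by
    induction X using TensorProduct.induction_on with
    | zero => simp
    | tmul a b => simp [← TensorProduct.smul_tmul']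
    | add a b ha hb => simp only [map_add, ha, hb, TensorProduct.add_tmul, add_mul]
  rw [εt_eq, comul_counitMulLeft, ← W.comul_one_left, key]

theorem comul_εt_right (W : WeakBialgebra k H) (h : H) :
    W.comul (W.εt h) = W.comul 1 * (W.εt h ⊗ₜ[k] 1) := by
  have key (X Y : H ⊗[k] H) : W.counitMulLeft h (H ⊗[k] H)
      ((1 ⊗ₜ[k] Y) * TensorProduct.assoc k H H H (X ⊗ₜ[k] 1)) =
      Y * (W.counitMulLeft h H X ⊗ₜ[k] 1) := by
    induction X using TensorProduct.induction_on with
    | zero => simp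
    | tmul a b => simp [← TensorProduct.smul_tmul']
    | add a b ha hb => simp only [map_add, ha, hb, TensorProduct.add_tmul, mul_add]
  rw [εt_eq, comul_counitMulLeft, ← W.comul_one_right, key]

theorem comul_εt_mul (W : WeakBialgebra k H) (h g : H) :
    W.comul (W.εt h * g) = (W.εt h ⊗ₜ[k] 1) * W.comul g := by
  rw [W.comul_mul, comul_εt_left, mul_assoc, comul_one_mul]

theorem comul_mul_εt (W : WeakBialgebra k H) (h g : H) :
    W.comul (g * W.εt h) = W.comul g * (W.εt h ⊗ₜ[k] 1) := by
  rw [W.comul_mul, comul_εt_right, ← mul_assoc, comul_mul_one]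

theorem comul_εs (W : WeakBialgebra k H) (h : H) :
    W.comul (W.εs h) = W.comul 1 * (1 ⊗ₜ[k] W.εs h) := by
  have key (X Y : H ⊗[k] H) : W.counitMulRight h (H ⊗[k] H)
      ((TensorProduct.assoc k H H H).symm (TensorProduct.assoc k H H H (X ⊗ₜ[k] 1) * (1 ⊗ₜ[k] Y))) =
      X * (1 ⊗ₜ[k] W.counitMulRight h H Y) := by
    induction X using TensorProduct.induction_on with
    | zero => simp
    | tmul a b =>
      induction Y using TensorProduct.induction_on with
      | zero => simp
      | tmul c d => simp
      | add c d hc hd => simp only [map_add, hc, hd, TensorProduct.tmul_add, mul_add]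
    | add a b ha hb => simp only [map_add, ha, hb, TensorProduct.add_tmul, add_mul]
  have key2 (X : H ⊗[k] H) : W.comul (W.counitMulRight h H X) =
      W.counitMulRight h (H ⊗[k] H) (W.comul.rTensor H X) := by
    induction X using TensorProduct.induction_on with
    | zero => simp
    | tmul a b => simp
    | add a b ha hb => simp only [map_add, ha, hb]
  rw [εs_eq, key2, ← (TensorProduct.assoc k H H H).symm_apply_apply (W.comul.rTensor H (W.comul 1)),
    W.coassoc, ← W.comul_one_left, key]

theorem lTensor_εt_comul_one (W : WeakBialgebra k H) :
    W.εt.lTensor H (W.comul 1) = W.comul 1 := by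
  have key (X Y : H ⊗[k] H) :
      LinearMap.lTensor H ((TensorProduct.lid k H).toLinearMap ∘ₗ LinearMap.rTensor H W.counit)
        ((1 ⊗ₜ[k] Y) * TensorProduct.assoc k H H H (X ⊗ₜ[k] 1)) =
      LinearMap.lTensor H ((TensorProduct.lid k H).toLinearMap ∘ₗ LinearMap.rTensor H W.counit ∘ₗ
        LinearMap.mulLeft k Y ∘ₗ (TensorProduct.mk k H H).flip 1) X := by
    induction X using TensorProduct.induction_on with
    | zero => simp
    | tmul a b => simp
    | add a b ha hb => simp only [map_add, ha, hb, TensorProduct.add_tmul, mul_add]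
  have := key (W.comul 1) (W.comul 1)
  rw [W.comul_one_right, ← LinearMap.lTensor_comp_apply] at this
  have h2 : ((TensorProduct.lid k H).toLinearMap ∘ₗ LinearMap.rTensor H W.counit) ∘ₗ W.comul =
      LinearMap.id := by
    ext x
    exact W.counit_comul x
  rw [h2, LinearMap.lTensor_id_apply] at this
  exact this.symm

theorem conv_id_εs (W : WeakBialgebra k H) : W.conv LinearMap.id W.εs = LinearMap.id := by
  ext h
  have key (X Y : H ⊗[k] H) : LinearMap.mul' k H (TensorProduct.map LinearMap.id
      ((TensorProduct.rid k H).toLinearMap ∘ₗ LinearMap.lTensor H W.counit ∘ₗ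
        LinearMap.mulRight k Y ∘ₗ TensorProduct.mk k H H 1) X) =
      TensorProduct.rid k H (LinearMap.lTensor H W.counit (X * Y)) := by
    induction X using TensorProduct.induction_on with
    | zero => simp
    | tmul a b =>
      induction Y using TensorProduct.induction_on with
      | zero => simp
      | tmul c d => simp
      | add c d hc hd =>
        simp only [map_add, mul_add, ← hc, ← hd, TensorProduct.map_tmul, LinearMap.mul'_apply,
          LinearMap.comp_apply, LinearMap.mulRight_apply]
    | add a b ha hb => simp only [map_add, ha, hb, add_mul]
  have := key (W.comul h) (W.comul 1)
  rwa [comul_mul_one, W.comul_counit] at this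

theorem counit_εs_mul (W : WeakBialgebra k H) (a x : H) :
    W.counit (W.εs a * x) = W.counit (a * x) := by
  have key (X : H ⊗[k] H) : W.counit (W.counitMulRight a H X * x) = LinearMap.mul' k k
      ((TensorProduct.map (W.counit ∘ₗ LinearMap.mulLeft k a)
        (W.counit ∘ₗ LinearMap.mulRight k x)) ((TensorProduct.comm k H H) X)) := by
    induction X using TensorProduct.induction_on with
    | zero => simp
    | tmul c d => simp
    | add c d hc hd => simp only [map_add, add_mul, hc, hd]
  rw [εs_eq, key, ← W.counit_weak', mul_one]

theorem counit_εt_mul (W : WeakBialgebra k H) (hc : ∀ a b : H, a * b = b * a) (a x : H) :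
    W.counit (W.εt a * x) = W.counit (a * x) := by
  have key (X : H ⊗[k] H) : W.counit (W.counitMulLeft a H X * x) = LinearMap.mul' k k
      ((TensorProduct.map (W.counit ∘ₗ LinearMap.mulLeft k a)
        (W.counit ∘ₗ LinearMap.mulRight k x)) X) := by
    induction X using TensorProduct.induction_on with
    | zero => simp
    | tmul c d => simp [hc a c]
    | add c d hc hd => simp only [map_add, add_mul, hc, hd]
  rw [εt_eq, key, ← W.counit_weak, mul_one]

theorem counitMulRight_congr (W : WeakBialgebra k H) {a b : H}
    (hab : ∀ x, W.counit (a * x) = W.counit (b * x)) :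
    W.counitMulRight a H = W.counitMulRight b H := by
  ext x y
  simp [hab]

theorem εs_εt (W : WeakBialgebra k H) (hc : ∀ a b : H, a * b = b * a) (a : H) :
    W.εs (W.εt a) = W.εs a := by
  rw [εs_eq, εs_eq, W.counitMulRight_congr (W.counit_εt_mul hc a)]

theorem εs_εs_mul (W : WeakBialgebra k H) (a b : H) : W.εs (W.εs a * b) = W.εs (a * b) := by
  rw [εs_eq, W.counitMulRight_congr (b := a * b), ← εs_eq]
  intro x
  rw [mul_assoc, counit_εs_mul, mul_assoc]

theorem counitMulRight_comul (W : WeakBialgebra k H) (hc : ∀ a b : H, a * b = b * a) (x y : H) :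
    W.counitMulRight y H (W.comul x) = x * W.εs y := by
  have key (X : H ⊗[k] H) : W.counitMulRight y H X =
      TensorProduct.rid k H (LinearMap.lTensor H W.counit (X * (1 ⊗ₜ[k] W.εs y))) := by
    induction X using TensorProduct.induction_on with
    | zero => simp
    | tmul c d => simp [hc d, counit_εs_mul]
    | add c d hc hd => simp only [map_add, add_mul, hc, hd]
  rw [key, ← W.comul_mul_one x, mul_assoc, ← W.comul_εs, ← W.comul_mul, W.comul_counit]

theorem εs_eq_self (W : WeakBialgebra k H) (hc : ∀ a b : H, a * b = b * a) {y : H}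
    (hy : W.comul y = W.comul 1 * (1 ⊗ₜ[k] y)) : W.εs y = y := by
  have key (X : H ⊗[k] H) : W.counitMulRight y H X =
      TensorProduct.rid k H (LinearMap.lTensor H W.counit (X * (1 ⊗ₜ[k] y))) := by
    induction X using TensorProduct.induction_on with
    | zero => simp
    | tmul c d => simp [hc d]
    | add c d hc hd => simp only [map_add, add_mul, hc, hd]
  rw [εs_eq, key, ← hy, W.comul_counit]

theorem εs_εs (W : WeakBialgebra k H) (hc : ∀ a b : H, a * b = b * a) (a : H) :
    W.εs (W.εs a) = W.εs a :=
  W.εs_eq_self hc (W.comul_εs a)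

theorem εs_mul (W : WeakBialgebra k H) (hc : ∀ a b : H, a * b = b * a) (a b : H) :
    W.εs (a * b) = W.εs a * W.εs b := by
  rw [← W.εs_εs_mul, hc, ← W.εs_εs_mul, hc]
  refine W.εs_eq_self hc ?_
  rw [W.comul_mul, W.comul_εs a, mul_assoc, W.comul_εs b, ← mul_assoc (1 ⊗ₜ[k] W.εs a)]
  have key (X : H ⊗[k] H) : (1 ⊗ₜ[k] W.εs a) * X = X * (1 ⊗ₜ[k] W.εs a) := by
    induction X using TensorProduct.induction_on with
    | zero => simp
    | tmul c d => simp [hc d]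
    | add c d hc hd => simp only [mul_add, add_mul, hc, hd]
  rw [key, mul_assoc, ← mul_assoc, W.comul_one_mul]
  simp

theorem conv_εs_εs (W : WeakBialgebra k H) (hc : ∀ a b : H, a * b = b * a) :
    W.conv W.εs W.εs = W.εs := by
  have key (X : H ⊗[k] H) : W.εs (LinearMap.mul' k H (TensorProduct.map LinearMap.id W.εs X)) =
      LinearMap.mul' k H (TensorProduct.map W.εs W.εs X) := by
    induction X using TensorProduct.induction_on with
    | zero => simp
    | tmul c d => simp [W.εs_mul hc, W.εs_εs hc]
    | add c d hc hd => simp only [map_add, hc, hd]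
  ext a
  rw [conv_apply, ← key, ← conv_apply, conv_id_εs, LinearMap.id_apply]

end WeakBialgebra

section MatchedPairLemmas

variable {k H A : Type*} [Field k] [Ring H] [Algebra k H] [Ring A] [Algebra k A]
variable {WH : WeakBialgebra k H} {WA : WeakBialgebra k A}
variable {act : H →ₗ[k] A →ₗ[k] A} {coact : H →ₗ[k] H ⊗[k] A}

variable (k H A) in
/-- The inclusion `a ↦ a ⊗ 1`. -/
def inclA : A →ₗ[k] A ⊗[k] H := (TensorProduct.mk k A H).flip 1

variable (k H A) in
/-- The inclusion `h ↦ 1 ⊗ h`. -/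
def inclH : H →ₗ[k] A ⊗[k] H := TensorProduct.mk k A H 1

@[simp] theorem inclA_apply (a : A) : inclA k H A a = a ⊗ₜ[k] (1 : H) := rfl

@[simp] theorem inclH_apply (h : H) : inclH k H A h = (1 : A) ⊗ₜ[k] h := rfl

theorem tmul_one_mul_comm (hc : ∀ a b : A, a * b = b * a) (a : A) (u : A ⊗[k] H) :
    (a ⊗ₜ[k] (1 : H)) * u = u * (a ⊗ₜ[k] (1 : H)) := by
  induction u using TensorProduct.induction_on with
  | zero => simp
  | tmul b h => simp [hc a]
  | add u v hu hv => simp only [mul_add, add_mul, hu, hv]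

/-- The map `h ↦ (h · 1) ⊗ 1`. -/
def actUnit (act : H →ₗ[k] A →ₗ[k] A) : H →ₗ[k] A ⊗[k] H := inclA k H A ∘ₗ act.flip 1

@[simp] theorem actUnit_apply (h : H) : actUnit act h = act h 1 ⊗ₜ[k] (1 : H) := rfl

/-- The `A`-linear extension of a map `H → A ⊗ H` to `A ⊗ H`. -/
def extA (f : H →ₗ[k] A ⊗[k] H) : A ⊗[k] H →ₗ[k] A ⊗[k] H :=
  LinearMap.mul' k _ ∘ₗ TensorProduct.map (inclA k H A) f

@[simp] theorem extA_tmul (f : H →ₗ[k] A ⊗[k] H) (a : A) (h : H) :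
    extA f (a ⊗ₜ[k] h) = (a ⊗ₜ[k] (1 : H)) * f h := by
  simp [extA]

theorem extA_mul (f : H →ₗ[k] A ⊗[k] H) (a : A) (u : A ⊗[k] H) :
    extA f ((a ⊗ₜ[k] (1 : H)) * u) = (a ⊗ₜ[k] (1 : H)) * extA f u := by
  induction u using TensorProduct.induction_on with
  | zero => simp
  | tmul b h => simp [← mul_assoc]
  | add u v hu hv => simp only [mul_add, map_add, hu, hv]

theorem extA_comp_inclH (f : H →ₗ[k] A ⊗[k] H) : extA f ∘ₗ inclH k H A = f := by
  ext h
  simp [← Algebra.TensorProduct.one_def]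

/-- The twist `h ↦ f(h⁰) s(h¹)` of a map `f`. -/
def twist (coact : H →ₗ[k] H ⊗[k] A) (s : A →ₗ[k] A) (f : H →ₗ[k] A ⊗[k] H) :
    H →ₗ[k] A ⊗[k] H :=
  LinearMap.mul' k _ ∘ₗ TensorProduct.map f (inclA k H A ∘ₗ s) ∘ₗ coact

theorem twist_apply (s : A →ₗ[k] A) (f : H →ₗ[k] A ⊗[k] H) (h : H) :
    twist coact s f h = LinearMap.mul' k _ (TensorProduct.map f (inclA k H A ∘ₗ s) (coact h)) :=
  rfl

theorem extA_comp_twist (hc : ∀ a b : A, a * b = b * a) (s : A →ₗ[k] A)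
    (f g : H →ₗ[k] A ⊗[k] H) :
    extA f ∘ₗ twist coact s g = twist coact s (extA f ∘ₗ g) := by
  ext h
  simp only [LinearMap.comp_apply, twist_apply]
  induction coact h using TensorProduct.induction_on with
  | zero => simp
  | tmul b h => simp [← tmul_one_mul_comm hc, extA_mul]
  | add u v hu hv => simp only [map_add, hu, hv]

theorem extA_comp_conv (f' : H →ₗ[k] A) (f g : H →ₗ[k] A ⊗[k] H) :
    extA f ∘ₗ WH.conv (inclA k H A ∘ₗ f') g = WH.conv (inclA k H A ∘ₗ f') (extA f ∘ₗ g) := by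
  ext h
  simp only [LinearMap.comp_apply, WeakBialgebra.conv_apply]
  induction WH.comul h using TensorProduct.induction_on with
  | zero => simp
  | tmul b h => simp [extA_mul]
  | add u v hu hv => simp only [map_add, hu, hv]

theorem twist_conv (hc : ∀ a b : A, a * b = b * a) (hco : IsComoduleCoalgebra k WH WA coact)
    {s : A →ₗ[k] A} (hs : ∀ a b, s (a * b) = s a * s b) (f g : H →ₗ[k] A ⊗[k] H) :
    twist coact s (WH.conv f g) = WH.conv (twist coact s f) (twist coact s g) := by
  ext h
  have k1 (X : H ⊗[k] A) : LinearMap.mul' k _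
        (TensorProduct.map (WH.conv f g) (inclA k H A ∘ₗ s) X) =
      LinearMap.mul' k _ (TensorProduct.map (LinearMap.mul' k _ ∘ₗ TensorProduct.map f g)
        (inclA k H A ∘ₗ s) (LinearMap.rTensor A WH.comul X)) := by
    induction X using TensorProduct.induction_on with
    | zero => simp
    | tmul b h => simp [WeakBialgebra.conv_apply]
    | add u v hu hv => simp only [map_add, hu, hv]
  have k2 (X Y : H ⊗[k] A) : LinearMap.mul' k _
        (TensorProduct.map (LinearMap.mul' k _ ∘ₗ TensorProduct.map f g) (inclA k H A ∘ₗ s)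
          (LinearMap.lTensor (H ⊗[k] H) (LinearMap.mul' k A)
            (TensorProduct.tensorTensorTensorComm k H A H A (X ⊗ₜ[k] Y)))) =
      LinearMap.mul' k _ (TensorProduct.map f (inclA k H A ∘ₗ s) X) *
        LinearMap.mul' k _ (TensorProduct.map g (inclA k H A ∘ₗ s) Y) := by
    induction X using TensorProduct.induction_on with
    | zero => simp
    | tmul h a =>
      induction Y using TensorProduct.induction_on with
      | zero => simp
      | tmul l b =>
        have : (s a * s b) ⊗ₜ[k] (1 : H) = (s a ⊗ₜ[k] (1 : H)) * (s b ⊗ₜ[k] 1) := by simp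
        simp only [TensorProduct.tensorTensorTensorComm_tmul, LinearMap.lTensor_tmul,
          LinearMap.mul'_apply, TensorProduct.map_tmul, LinearMap.comp_apply, hs, inclA_apply, this]
        rw [mul_assoc, mul_assoc, ← mul_assoc (g l), ← tmul_one_mul_comm hc (s a) (g l), mul_assoc]
      | add u v hu hv => simp only [TensorProduct.tmul_add, map_add, mul_add, hu, hv]
    | add u v hu hv => simp only [TensorProduct.add_tmul, map_add, add_mul, hu, hv]
  have k3 (X : H ⊗[k] H) : LinearMap.mul' k _
        (TensorProduct.map (LinearMap.mul' k _ ∘ₗ TensorProduct.map f g) (inclA k H A ∘ₗ s)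
          (LinearMap.lTensor (H ⊗[k] H) (LinearMap.mul' k A)
            (TensorProduct.tensorTensorTensorComm k H A H A (TensorProduct.map coact coact X)))) =
      LinearMap.mul' k _ (TensorProduct.map (twist coact s f) (twist coact s g) X) := by
    induction X using TensorProduct.induction_on with
    | zero => simp
    | tmul a b => rw [TensorProduct.map_tmul, k2]; simp [twist_apply]
    | add u v hu hv => simp only [map_add, hu, hv]
  rw [twist_apply, k1, hco.comul_coact, k3, WeakBialgebra.conv_apply]

theorem twist_twist (hco : IsComoduleCoalgebra k WH WA coact)
    {s : A →ₗ[k] A} (hs : WA.conv s s = s) (f : H →ₗ[k] A ⊗[k] H) :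
    twist coact s (twist coact s f) = twist coact s f := by
  ext h
  have k1 (X : H ⊗[k] A) : LinearMap.mul' k _
        (TensorProduct.map (twist coact s f) (inclA k H A ∘ₗ s) X) =
      LinearMap.mul' k _ (TensorProduct.map f
        (inclA k H A ∘ₗ LinearMap.mul' k A ∘ₗ TensorProduct.map s s)
          (TensorProduct.assoc k H A A (LinearMap.rTensor A coact X))) := by
    induction X using TensorProduct.induction_on with
    | zero => simp
    | tmul h a =>
      simp only [TensorProduct.map_tmul, LinearMap.rTensor_tmul, twist_apply]
      induction coact h using TensorProduct.induction_on with
      | zero => simp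
      | tmul l b => simp [mul_assoc]
      | add u v hu hv => simp only [TensorProduct.add_tmul, map_add, hu, hv]
    | add u v hu hv => simp only [map_add, hu, hv]
  rw [twist_apply, k1, hco.coact_coact, twist_apply, ← LinearMap.comp_apply (TensorProduct.map _ _),
    LinearMap.map_comp_lTensor]
  conv_rhs => rw [← hs]
  rfl

theorem twist_convOne (s : A →ₗ[k] A) :
    twist coact s (WH.convOne (A ⊗[k] H)) = inclA k H A ∘ₗ s ∘ₗ coactCounit k WH coact := by
  ext h
  simp only [LinearMap.comp_apply, twist_apply, coactCounit, LinearEquiv.coe_coe]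
  induction coact h using TensorProduct.induction_on with
  | zero => simp
  | tmul l b => simp [WeakBialgebra.convOne, ← Algebra.smul_def, TensorProduct.smul_tmul']
  | add u v hu hv => simp only [map_add, hu, hv]

/-- Evaluation of a twisted convolution at `1` by means of the axiom for `ρ(1₁) ⊗ 1₂`. -/
theorem conv_twist_one (hP : IsWeakMatchedPair k WH WA act coact) (s : A →ₗ[k] A)
    (f g : H →ₗ[k] A ⊗[k] H) :
    WH.conv (twist coact s f) g 1 =
      LinearMap.mul' k _ (TensorProduct.map
        (LinearMap.mul' k _ ∘ₗ TensorProduct.map f (twist coact s (WH.convOne (A ⊗[k] H))))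
        (g ∘ₗ LinearMap.mul' k H) (TensorProduct.tensorTensorTensorComm k H H H H
          (WH.comul 1 ⊗ₜ[k] WH.comul 1))) := by
  have k1 (X : H ⊗[k] H) : LinearMap.mul' k _ (TensorProduct.map (twist coact s f) g X) =
      LinearMap.mul' k _ (TensorProduct.map
        (LinearMap.mul' k _ ∘ₗ TensorProduct.map f (inclA k H A ∘ₗ s)) g
          (LinearMap.rTensor H coact X)) := by
    induction X using TensorProduct.induction_on with
    | zero => simp
    | tmul h a => simp [twist_apply]
    | add u v hu hv => simp only [map_add, hu, hv]
  rw [WeakBialgebra.conv_apply, k1, hP.cond5, ← LinearMap.comp_apply (TensorProduct.map _ _),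
    ← TensorProduct.map_comp, LinearMap.comp_assoc, LinearMap.map_comp_lTensor, twist_convOne]
  rfl

theorem IsModuleAlgebra.conv_act (hM : IsModuleAlgebra k WH act) (x y : A) :
    WH.conv (act.flip x) (act.flip y) = act.flip (x * y) := by
  ext h
  simp [WeakBialgebra.conv_apply, hM.act_mul]

theorem conv_comp_inclA (f g : H →ₗ[k] A) :
    WH.conv (inclA k H A ∘ₗ f) (inclA k H A ∘ₗ g) = inclA k H A ∘ₗ WH.conv f g := by
  ext h
  simp only [WeakBialgebra.conv_apply, LinearMap.comp_apply]
  induction WH.comul h using TensorProduct.induction_on with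
  | zero => simp
  | tmul l b => simp
  | add u v hu hv => simp only [map_add, hu, hv]

theorem IsModuleAlgebra.conv_actUnit (hM : IsModuleAlgebra k WH act) :
    WH.conv (actUnit act) (actUnit act) = actUnit act := by
  rw [actUnit, conv_comp_inclA, hM.conv_act, one_mul]

theorem IsModuleAlgebra.act_εt (hM : IsModuleAlgebra k WH act) (hco : WH.Cocomm)
    (h : H) (x : A) : act (WH.εt h) x = x * act h 1 := by
  have key (X : H ⊗[k] H) (z : H) : LinearMap.mul' k A
      (TensorProduct.map (act.flip x) (act.flip 1) (X * (1 ⊗ₜ[k] z))) =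
      LinearMap.mul' k A (TensorProduct.map (act.flip x) (act.flip (act z 1)) X) := by
    induction X using TensorProduct.induction_on with
    | zero => simp
    | tmul l b => simp [hM.act_act]
    | add u v hu hv => simp only [map_add, add_mul, hu, hv]
  have hz : WH.comul (WH.εt h) = WH.comul 1 * (1 ⊗ₜ[k] WH.εt h) := by
    rw [← hco, WH.comul_εt_right]
    conv_rhs => rw [← hco]
    generalize WH.comul 1 = X
    induction X using TensorProduct.induction_on with
    | zero => simp
    | tmul l b => simp
    | add u v hu hv => simp only [map_add, add_mul, hu, hv]
  conv_lhs => rw [← mul_one x, hM.act_mul, hz, key, ← hM.act_mul, hM.one_act, ← hM.act_unit]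

theorem IsCompatiblePair.act_εs (hCP : IsCompatiblePair k WH WA act coact) (h : H) (b : A) :
    act h (WA.εs b) = act h 1 * WA.εs b := by
  have hM := hCP.pair.moduleAlgebra
  have k1 (X : A ⊗[k] A) : act h (WA.counitMulRight b A X) =
      WA.counitMulRight b A (TensorProduct.map (act h) (act 1) X) := by
    induction X using TensorProduct.induction_on with
    | zero => simp
    | tmul l b => simp [hM.one_act]
    | add u v hu hv => simp only [map_add, hu, hv]
  have k2 (X : A ⊗[k] A) : WA.counitMulRight b A (TensorProduct.map
      (LinearMap.mulLeft k (act h 1)) (LinearMap.mulLeft k (act 1 1)) X) =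
      act h 1 * WA.counitMulRight b A X := by
    induction X using TensorProduct.induction_on with
    | zero => simp
    | tmul l b => simp [hM.one_act]
    | add u v hu hv => simp only [map_add, mul_add, hu, hv]
  rw [WA.εs_eq, k1, hCP.compat2, k2]

theorem IsCompatiblePair.act_mul_εs (hCP : IsCompatiblePair k WH WA act coact) (h : H) (x b : A) :
    act h (x * WA.εs b) = act h x * WA.εs b := by
  have hM := hCP.pair.moduleAlgebra
  have k1 (X : H ⊗[k] H) : LinearMap.mul' k A
      (TensorProduct.map (act.flip x) (act.flip (WA.εs b)) X) =
      LinearMap.mul' k A (TensorProduct.map (act.flip x) (act.flip 1) X) * WA.εs b := by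
    induction X using TensorProduct.induction_on with
    | zero => simp
    | tmul l b => simp [hCP.act_εs, mul_assoc]
    | add u v hu hv => simp only [map_add, add_mul, hu, hv]
  rw [hM.act_mul, k1, ← hM.act_mul, mul_one]

theorem IsCompatiblePair.conv_act_εs_act (hCP : IsCompatiblePair k WH WA act coact) :
    WH.conv (act.flip 1) (WA.εs ∘ₗ act.flip 1) = act.flip 1 := by
  ext h
  have k1 (a b : A) (Y : A ⊗[k] A) : TensorProduct.rid k A (TensorProduct.map
      (LinearMap.mulLeft k a) (WA.counit ∘ₗ LinearMap.mulLeft k b) Y) =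
      a * WA.counitMulRight b A Y := by
    induction Y using TensorProduct.induction_on with
    | zero => simp
    | tmul l b => simp
    | add u v hu hv => simp only [map_add, mul_add, hu, hv]
  have k2 (h g : H) (Y : A ⊗[k] A) :
      TensorProduct.map (TensorProduct.lift act) (WA.counit ∘ₗ TensorProduct.lift act)
        (TensorProduct.tensorTensorTensorComm k H H A A ((h ⊗ₜ[k] g) ⊗ₜ[k] Y)) =
      LinearMap.lTensor A WA.counit (TensorProduct.map (act h) (act g) Y) := by
    induction Y using TensorProduct.induction_on with
    | zero => simp
    | tmul l b => simp
    | add u v hu hv => simp only [map_add, TensorProduct.tmul_add, hu, hv]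
  have k3 (X : H ⊗[k] H) : TensorProduct.rid k A
      (TensorProduct.map (TensorProduct.lift act) (WA.counit ∘ₗ TensorProduct.lift act)
        (TensorProduct.tensorTensorTensorComm k H H A A (X ⊗ₜ[k] WA.comul 1))) =
      LinearMap.mul' k A (TensorProduct.map (act.flip 1) (WA.εs ∘ₗ act.flip 1) X) := by
    induction X using TensorProduct.induction_on with
    | zero => simp
    | tmul h g => simp [k2, hCP.compat2, k1, WA.εs_eq]
    | add u v hu hv => simp only [map_add, TensorProduct.add_tmul, hu, hv]
  rw [WeakBialgebra.conv_apply, ← k3, ← hCP.compat1, LinearMap.flip_apply]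

theorem IsCompatiblePair.εs_act_one (hCP : IsCompatiblePair k WH WA act coact) (h : H) :
    WA.εs (act h 1) = act h 1 := by
  have hM := hCP.pair.moduleAlgebra
  have hE := hCP.conv_act_εs_act
  have key (X : H ⊗[k] H) (z : H) : LinearMap.mul' k A
      (TensorProduct.map (act.flip 1) (WA.εs ∘ₗ act.flip 1) (X * (1 ⊗ₜ[k] z))) =
      LinearMap.mul' k A (TensorProduct.map (act.flip 1) (WA.εs ∘ₗ act.flip 1) X) *
        WA.εs (act z 1) := by
    induction X using TensorProduct.induction_on with
    | zero => simp
    | tmul l b => simp [← hM.act_act, hCP.pair.cond4 b (act z 1), mul_assoc]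
    | add u v hu hv => simp only [map_add, add_mul, hu, hv]
  have h1 := LinearMap.congr_fun hE 1
  have h2 := LinearMap.congr_fun hE (WH.εt h)
  have hz : WH.comul (WH.εt h) = WH.comul 1 * (1 ⊗ₜ[k] WH.εt h) := by
    rw [← hCP.cocomm, WH.comul_εt_right]
    conv_rhs => rw [← hCP.cocomm]
    generalize WH.comul 1 = X
    induction X using TensorProduct.induction_on with
    | zero => simp
    | tmul l b => simp
    | add u v hu hv => simp only [map_add, add_mul, hu, hv]
  rw [WeakBialgebra.conv_apply] at h1 h2
  rw [hz, key, h1] at h2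
  simpa [hM.one_act, ← hM.act_unit] using h2

theorem IsCompatiblePair.act_mul_one (hCP : IsCompatiblePair k WH WA act coact) (h g : H) :
    act (h * g) 1 = act h 1 * act g 1 := by
  rw [← hCP.pair.moduleAlgebra.act_act, ← hCP.εs_act_one g, hCP.act_εs]

theorem IsCompatiblePair.actUnit_mul (hCP : IsCompatiblePair k WH WA act coact) (h g : H) :
    actUnit act (h * g) = actUnit act h * actUnit act g := by
  simp [hCP.act_mul_one]

theorem IsCompatiblePair.actUnit_εt (hCP : IsCompatiblePair k WH WA act coact) (h : H) :
    actUnit act (WH.εt h) = actUnit act h := by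
  simp [← hCP.pair.moduleAlgebra.act_unit]

/-- `a ⊗ b ↦ ε(a) εs(b) ⊗ 1`. -/
def counitεs (H : Type*) [Ring H] [Algebra k H] (WA : WeakBialgebra k A) :
    A ⊗[k] A →ₗ[k] A ⊗[k] H :=
  inclA k H A ∘ₗ (TensorProduct.lid k A).toLinearMap ∘ₗ TensorProduct.map WA.counit WA.εs

@[simp] theorem counitεs_tmul (a b : A) :
    counitεs H WA (a ⊗ₜ[k] b) = (WA.counit a • WA.εs b) ⊗ₜ[k] (1 : H) := by
  simp [counitεs, TensorProduct.smul_tmul']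

/-- `h ⊗ b ↦ εs(b) ⊗ h`. -/
def εsFlip (H : Type*) [Ring H] [Algebra k H] (WA : WeakBialgebra k A) :
    H ⊗[k] A →ₗ[k] A ⊗[k] H :=
  (TensorProduct.comm k H A).toLinearMap ∘ₗ LinearMap.lTensor H WA.εs

@[simp] theorem εsFlip_tmul (h : H) (b : A) :
    εsFlip H WA (h ⊗ₜ[k] b) = WA.εs b ⊗ₜ[k] h := by
  simp [εsFlip]

theorem εsFlip_coact (h : H) :
    εsFlip H WA (coact h) = twist coact WA.εs (inclH k H A) h := by
  rw [twist_apply]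
  induction coact h using TensorProduct.induction_on with
  | zero => simp
  | tmul l b => simp
  | add u v hu hv => simp only [map_add, hu, hv]

theorem IsCompatiblePair.counitεs_pairMapA (hCP : IsCompatiblePair k WH WA act coact) (h g : H) :
    counitεs H WA (pairMapA k act coact ((h ⊗ₜ[k] g) ⊗ₜ[k] WA.comul 1)) =
      twist coact WA.εs (actUnit act) h * actUnit act g := by
  have hc := hCP.comm
  have k1 (X : A ⊗[k] A) : counitεs H WA (pairMapA k act coact ((h ⊗ₜ[k] g) ⊗ₜ[k] X)) =
      LinearMap.mul' k _ (TensorProduct.map (counitεs H WA ∘ₗ LinearMap.lTensor A (act g) ∘ₗ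
        (LinearMap.rTensorHom A ∘ₗ act).flip X) (inclA k H A ∘ₗ WA.εs) (coact h)) := by
    induction X using TensorProduct.induction_on with
    | zero => simp
    | tmul x y =>
      simp only [pairMapA, LinearMap.comp_apply, LinearEquiv.coe_coe,
        TensorProduct.tensorTensorTensorComm_tmul, TensorProduct.map_tmul, LinearMap.rTensor_tmul]
      induction coact h using TensorProduct.induction_on with
      | zero => simp
      | tmul l b =>
        simp [WA.εs_mul hc, hc (WA.εs b)]
      | add u v hu hv => simp only [TensorProduct.add_tmul, map_add, hu, hv]
    | add u v hu hv =>
      simp only [TensorProduct.tmul_add, map_add, LinearMap.comp_add, hu, hv,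
        TensorProduct.map_add_left, LinearMap.add_apply]
  have k2 (a b : A) (Y : A ⊗[k] A) : counitεs H WA
      (TensorProduct.map (LinearMap.mulLeft k a) (LinearMap.mulLeft k b) Y) =
      (WA.εs b * WA.εs (WA.counitMulLeft a A Y)) ⊗ₜ[k] 1 := by
    induction Y using TensorProduct.induction_on with
    | zero => simp
    | tmul l c => simp [WA.εs_mul hc, hc]
    | add u v hu hv => simp only [map_add, mul_add, TensorProduct.add_tmul, hu, hv]
  have k3 : counitεs H WA ∘ₗ LinearMap.lTensor A (act g) ∘ₗ
      (LinearMap.rTensorHom A ∘ₗ act).flip (WA.comul 1) =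
      LinearMap.mulRight k (actUnit act g) ∘ₗ actUnit act := by
    ext l
    have : LinearMap.lTensor A (act g) (LinearMap.rTensor A (act l) (WA.comul 1)) =
        TensorProduct.map (act l) (act g) (WA.comul 1) := by
      rw [← LinearMap.comp_apply, LinearMap.lTensor_comp_rTensor]
    simp only [LinearMap.comp_apply, LinearMap.flip_apply, LinearMap.coe_rTensorHom, this,
      hCP.compat2, k2, ← WA.εt_eq, WA.εs_εt hc, hCP.εs_act_one, LinearMap.mulRight_apply,
      actUnit_apply, Algebra.TensorProduct.tmul_mul_tmul, mul_one, hc (act g 1)]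
  rw [k1, k3, twist_apply]
  induction coact h using TensorProduct.induction_on with
  | zero => simp
  | tmul l b => simp [mul_assoc, hc (act g 1)]
  | add u v hu hv => simp only [map_add, add_mul, hu, hv]

theorem conv_inclA_comm (hc : ∀ a b : A, a * b = b * a) (hco : WH.Cocomm) (f' : H →ₗ[k] A)
    (g : H →ₗ[k] A ⊗[k] H) :
    WH.conv (inclA k H A ∘ₗ f') g = WH.conv g (inclA k H A ∘ₗ f') :=
  WH.conv_comm hco fun _ _ => tmul_one_mul_comm hc _ _

theorem conv_actUnit_comm (hc : ∀ a b : A, a * b = b * a) (hco : WH.Cocomm)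
    (g : H →ₗ[k] A ⊗[k] H) :
    WH.conv (actUnit act) g = WH.conv g (actUnit act) :=
  conv_inclA_comm hc hco _ g

theorem IsModuleAlgebra.conv_actUnit_conv (hM : IsModuleAlgebra k WH act)
    (g : H →ₗ[k] A ⊗[k] H) :
    WH.conv (actUnit act) (WH.conv (actUnit act) g) = WH.conv (actUnit act) g := by
  rw [← WH.conv_assoc, hM.conv_actUnit]

theorem twist_inclA (s : A →ₗ[k] A) (f : H →ₗ[k] A) :
    twist coact s (inclA k H A ∘ₗ f) =
      inclA k H A ∘ₗ LinearMap.mul' k A ∘ₗ TensorProduct.map f s ∘ₗ coact := by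
  ext h
  simp only [twist_apply, LinearMap.comp_apply]
  induction coact h using TensorProduct.induction_on with
  | zero => simp
  | tmul l b => simp
  | add u v hu hv => simp only [map_add, hu, hv]

theorem conv_conv_conv_apply {B : Type*} [Ring B] [Algebra k B] (f₁ f₂ f₃ f₄ : H →ₗ[k] B) (h : H) :
    WH.conv f₁ (WH.conv f₂ (WH.conv f₃ f₄)) h =
      LinearMap.mul' k B (TensorProduct.map (LinearMap.mul' k B ∘ₗ TensorProduct.map f₁ f₂)
        (LinearMap.mul' k B ∘ₗ TensorProduct.map f₃ f₄)
          ((TensorProduct.assoc k H H (H ⊗[k] H)).symm (threeComul k WH h))) := by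
  have k1 (X : H ⊗[k] (H ⊗[k] (H ⊗[k] H))) : LinearMap.mul' k B (TensorProduct.map f₁
      (LinearMap.mul' k B ∘ₗ TensorProduct.map f₂ (LinearMap.mul' k B ∘ₗ TensorProduct.map f₃ f₄)) X) =
      LinearMap.mul' k B (TensorProduct.map (LinearMap.mul' k B ∘ₗ TensorProduct.map f₁ f₂)
        (LinearMap.mul' k B ∘ₗ TensorProduct.map f₃ f₄)
          ((TensorProduct.assoc k H H (H ⊗[k] H)).symm X)) := by
    induction X using TensorProduct.induction_on with
    | zero => simp
    | tmul a Y =>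
      induction Y using TensorProduct.induction_on with
      | zero => simp
      | tmul b c => simp [mul_assoc]
      | add u v hu hv => simp only [TensorProduct.tmul_add, map_add, hu, hv]
    | add u v hu hv => simp only [map_add, hu, hv]
  rw [← k1]
  have k2 (f g : H →ₗ[k] B) : WH.conv f g =
    (LinearMap.mul' k B ∘ₗ TensorProduct.map f g) ∘ₗ WH.comul := rfl
  simp only [k2, threeComul, LinearMap.comp_apply]
  congr 1
  simp only [← LinearMap.comp_apply (TensorProduct.map _ _), LinearMap.map_comp_lTensor]
  simp only [LinearMap.comp_assoc, LinearMap.map_comp_lTensor]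

theorem εsFlip_pairMapH (hCP : IsCompatiblePair k WH WA act coact) (h l : H) (Y : H ⊗[k] A) :
    εsFlip H WA (pairMapH k act coact ((h ⊗ₜ[k] l) ⊗ₜ[k] Y)) =
      twist coact WA.εs (inclH k H A) h * actUnit act l * εsFlip H WA Y := by
  have hc := hCP.comm
  induction Y using TensorProduct.induction_on with
  | zero => simp
  | tmul x y =>
    simp only [pairMapH, LinearMap.comp_apply, LinearEquiv.coe_coe, twist_apply,
      TensorProduct.tensorTensorTensorComm_tmul, TensorProduct.map_tmul, LinearMap.rTensor_tmul]
    induction coact h using TensorProduct.induction_on with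
    | zero => simp
    | tmul m b =>
      simp [WA.εs_mul hc, hCP.pair.cond4 l y, hCP.εs_act_one, mul_assoc]
    | add u v hu hv => simp only [TensorProduct.add_tmul, map_add, add_mul, hu, hv]
  | add u v hu hv => simp only [TensorProduct.tmul_add, map_add, mul_add, hu, hv]

/-- The map `h ↦ 1_A ♯♯ h`. -/
def projH (WH : WeakBialgebra k H) (WA : WeakBialgebra k A) (act : H →ₗ[k] A →ₗ[k] A)
    (coact : H →ₗ[k] H ⊗[k] A) : H →ₗ[k] A ⊗[k] H :=
  WH.conv (actUnit act) (twist coact WA.εs (inclH k H A))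

/-- The map `h ↦ (h₁ · 1) (h₂⁰ · 1) εs(h₂¹) εs(h₃¹) ⊗ h₃⁰`. -/
def projHTwist (WH : WeakBialgebra k H) (WA : WeakBialgebra k A) (act : H →ₗ[k] A →ₗ[k] A)
    (coact : H →ₗ[k] H ⊗[k] A) : H →ₗ[k] A ⊗[k] H :=
  WH.conv (actUnit act) (WH.conv (twist coact WA.εs (actUnit act))
    (twist coact WA.εs (inclH k H A)))

/-- Condition (iii) of a matched pair, after applying `(ε ⊗ id) ⊗ εs`. -/
theorem IsCompatiblePair.conv_actUnit_twist_mulRight (hCP : IsCompatiblePair k WH WA act coact)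
    (h g : H) :
    WH.conv (actUnit act) (twist coact WA.εs (inclH k H A) ∘ₗ LinearMap.mulRight k g) h =
      projHTwist WH WA act coact h * twist coact WA.εs (inclH k H A) g := by
  have hc := hCP.comm
  have hM := hCP.pair.moduleAlgebra
  let Φ : (A ⊗[k] H) ⊗[k] A →ₗ[k] A ⊗[k] H := LinearMap.mul' k _ ∘ₗ
    TensorProduct.map (inclH k H A ∘ₗ (TensorProduct.lid k H).toLinearMap ∘ₗ
      LinearMap.rTensor H WA.counit) (inclA k H A ∘ₗ WA.εs)
  have k1 (u : A ⊗[k] A) (v : H ⊗[k] A) : Φ (LinearMap.lTensor (A ⊗[k] H) (LinearMap.mul' k A)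
      (TensorProduct.tensorTensorTensorComm k A A H A (u ⊗ₜ[k] v))) =
        counitεs H WA u * εsFlip H WA v := by
    induction u using TensorProduct.induction_on with
    | zero => simp
    | tmul a b =>
      induction v using TensorProduct.induction_on with
      | zero => simp
      | tmul c d => simp [Φ, WA.εs_mul hc, TensorProduct.smul_tmul]
      | add u v hu hv => simp only [TensorProduct.tmul_add, map_add, mul_add, hu, hv]
    | add u v hu hv => simp only [TensorProduct.add_tmul, map_add, add_mul, hu, hv]
  have k2 {M : Type _} [AddCommGroup M] [Module k M] (f : M →ₗ[k] A ⊗[k] A)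
      (g : M →ₗ[k] H ⊗[k] A) (X : M ⊗[k] M) :
      Φ (LinearMap.lTensor (A ⊗[k] H) (LinearMap.mul' k A)
        (TensorProduct.tensorTensorTensorComm k A A H A (TensorProduct.map f g X))) =
        LinearMap.mul' k _ (TensorProduct.map (counitεs H WA ∘ₗ f) (εsFlip H WA ∘ₗ g) X) := by
    induction X using TensorProduct.induction_on with
    | zero => simp
    | tmul a b => simp [k1]
    | add u v hu hv => simp only [map_add, hu, hv]
  have k3 (a : A) : counitεs H WA (WA.comul a) = inclA k H A (WA.εs a) := by
    conv_rhs => rw [← WA.counit_comul a]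
    induction WA.comul a using TensorProduct.induction_on with
    | zero => simp
    | tmul a b => simp [TensorProduct.smul_tmul']
    | add u v hu hv => simp only [map_add, hu, hv]
  have e1 : counitεs H WA ∘ₗ WA.comul ∘ₗ act.flip 1 = actUnit act := by
    ext l; simp [k3, hCP.εs_act_one]
  have e2 : εsFlip H WA ∘ₗ coact ∘ₗ LinearMap.mulRight k g =
      twist coact WA.εs (inclH k H A) ∘ₗ LinearMap.mulRight k g := by
    ext l; simp [εsFlip_coact]
  have e3 : counitεs H WA ∘ₗ pairMapA k act coact ∘ₗ
      (TensorProduct.mk k (H ⊗[k] H) (A ⊗[k] A)).flip (WA.comul 1) =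
      LinearMap.mul' k _ ∘ₗ TensorProduct.map (twist coact WA.εs (actUnit act)) (actUnit act) := by
    ext l m : 3; simp [hCP.counitεs_pairMapA]
  have e4 : εsFlip H WA ∘ₗ pairMapH k act coact ∘ₗ
      (TensorProduct.mk k (H ⊗[k] H) (H ⊗[k] A)).flip (coact g) =
      LinearMap.mulRight k (twist coact WA.εs (inclH k H A) g) ∘ₗ LinearMap.mul' k _ ∘ₗ
        TensorProduct.map (twist coact WA.εs (inclH k H A)) (actUnit act) := by
    ext l m : 3; simp [εsFlip_pairMapH hCP, εsFlip_coact]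
  have k5 {M : Type _} [AddCommGroup M] [Module k M] (f g : M →ₗ[k] A ⊗[k] H) (b : A ⊗[k] H)
      (X : M ⊗[k] M) :
      LinearMap.mul' k _ (TensorProduct.map f (LinearMap.mulRight k b ∘ₗ g) X) =
        LinearMap.mul' k _ (TensorProduct.map f g X) * b := by
    induction X using TensorProduct.induction_on with
    | zero => simp
    | tmul a b => simp [mul_assoc]
    | add u v hu hv => simp only [map_add, add_mul, hu, hv]
  have h3 := congrArg Φ (hCP.pair.cond3 h g 1)
  rw [mpLHS, mpRHS, k2, k2, e1, e2, e3, e4, k5, ← conv_conv_conv_apply,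
    ← conv_actUnit_comm hc hCP.cocomm, hM.conv_actUnit_conv, ← WH.conv_assoc,
    ← conv_actUnit_comm hc hCP.cocomm, WH.conv_assoc] at h3
  exact h3

theorem IsCompatiblePair.projH_mul (hCP : IsCompatiblePair k WH WA act coact) (h g : H) :
    projH WH WA act coact (h * g) = projHTwist WH WA act coact h * projH WH WA act coact g := by
  have hc := hCP.comm
  have k1 (a b : H) (X : H ⊗[k] H) : LinearMap.mul' k _ (TensorProduct.map (actUnit act)
      (twist coact WA.εs (inclH k H A)) (X * (a ⊗ₜ[k] b))) =
      actUnit act a * LinearMap.mul' k _ (TensorProduct.map (actUnit act)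
        (twist coact WA.εs (inclH k H A) ∘ₗ LinearMap.mulRight k b) X) := by
    induction X using TensorProduct.induction_on with
    | zero => simp
    | tmul l m => simp [hCP.act_mul_one, ← mul_assoc, hc (act a 1)]
    | add u v hu hv => simp only [map_add, mul_add, add_mul, hu, hv]
  have k2 (Y : H ⊗[k] H) : LinearMap.mul' k _ (TensorProduct.map (actUnit act)
      (twist coact WA.εs (inclH k H A)) (WH.comul h * Y)) =
      projHTwist WH WA act coact h * LinearMap.mul' k _ (TensorProduct.map (actUnit act)
        (twist coact WA.εs (inclH k H A)) Y) := by
    induction Y using TensorProduct.induction_on with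
    | zero => simp
    | tmul a b =>
      rw [k1, ← WeakBialgebra.conv_apply, hCP.conv_actUnit_twist_mulRight, actUnit_apply,
        ← mul_assoc, tmul_one_mul_comm hc]
      simp [mul_assoc]
    | add u v hu hv => simp only [map_add, mul_add, hu, hv]
  rw [projH, WeakBialgebra.conv_apply, WH.comul_mul, k2, WeakBialgebra.conv_apply]

theorem IsCompatiblePair.projH_εt_mul (hCP : IsCompatiblePair k WH WA act coact) (h g : H) :
    projH WH WA act coact (WH.εt h * g) = actUnit act h * projH WH WA act coact g := by
  have k1 (X : H ⊗[k] H) : LinearMap.mul' k _ (TensorProduct.map (actUnit act)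
      (twist coact WA.εs (inclH k H A)) ((WH.εt h ⊗ₜ[k] 1) * X)) =
      actUnit act h * LinearMap.mul' k _ (TensorProduct.map (actUnit act)
        (twist coact WA.εs (inclH k H A)) X) := by
    induction X using TensorProduct.induction_on with
    | zero => simp
    | tmul l m => simp [hCP.actUnit_mul, hCP.actUnit_εt, mul_assoc, -actUnit_apply]
    | add u v hu hv => simp only [map_add, mul_add, hu, hv]
  rw [projH, WeakBialgebra.conv_apply, WH.comul_εt_mul, k1, WeakBialgebra.conv_apply]

/-- The element `ε(1₁⁰) 1₁¹ (1₂ · 1)` of `A`. -/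
def pairUnit (WH : WeakBialgebra k H) (act : H →ₗ[k] A →ₗ[k] A) (coact : H →ₗ[k] H ⊗[k] A) : A :=
  WH.conv (coactCounit k WH coact) (act.flip 1) 1

theorem conv_coactCounit_actUnit_one :
    WH.conv (inclA k H A ∘ₗ coactCounit k WH coact) (actUnit act) 1 =
      pairUnit WH act coact ⊗ₜ[k] 1 := by
  rw [actUnit, conv_comp_inclA]
  rfl

theorem IsCompatiblePair.conv_actUnit_mul_εt (hCP : IsCompatiblePair k WH WA act coact)
    (g : H →ₗ[k] A ⊗[k] H) (x y : H) :
    WH.conv (actUnit act) g (x * WH.εt y) = actUnit act y * WH.conv (actUnit act) g x := by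
  have key (X : H ⊗[k] H) : LinearMap.mul' k _ (TensorProduct.map (actUnit act) g
      (X * (WH.εt y ⊗ₜ[k] 1))) =
      actUnit act y * LinearMap.mul' k _ (TensorProduct.map (actUnit act) g X) := by
    induction X using TensorProduct.induction_on with
    | zero => simp
    | tmul a b =>
      simp only [Algebra.TensorProduct.tmul_mul_tmul, mul_one, TensorProduct.map_tmul,
        LinearMap.mul'_apply, hCP.actUnit_mul, hCP.actUnit_εt, ← mul_assoc]
      congr 1
      simp [hCP.comm (act a 1)]
    | add u v hu hv => simp only [map_add, mul_add, add_mul, hu, hv]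
  rw [WeakBialgebra.conv_apply, WH.comul_mul_εt, key, WeakBialgebra.conv_apply]

/-- Twists may be removed at `1`, at the cost of a central factor. -/
theorem IsCompatiblePair.conv_twist_conv_one (hCP : IsCompatiblePair k WH WA act coact)
    {s : A →ₗ[k] A} (hs : s ∘ₗ coactCounit k WH coact = coactCounit k WH coact)
    (f g : H →ₗ[k] A ⊗[k] H) :
    WH.conv (twist coact s f) (WH.conv (actUnit act) g) 1 =
      (pairUnit WH act coact ⊗ₜ[k] 1) * WH.conv f (WH.conv (actUnit act) g) 1 := by
  have hc := hCP.comm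
  have key (X Y : H ⊗[k] H) : LinearMap.mul' k _ (TensorProduct.map
        (LinearMap.mul' k _ ∘ₗ TensorProduct.map f (inclA k H A ∘ₗ coactCounit k WH coact))
        (WH.conv (actUnit act) g ∘ₗ LinearMap.mul' k H)
          (TensorProduct.tensorTensorTensorComm k H H H H (X ⊗ₜ[k] LinearMap.lTensor H WH.εt Y))) =
      LinearMap.mul' k _ (TensorProduct.map (inclA k H A ∘ₗ coactCounit k WH coact)
        (actUnit act) Y) *
      LinearMap.mul' k _ (TensorProduct.map f (WH.conv (actUnit act) g) X) := by
    induction X using TensorProduct.induction_on with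
    | zero => simp
    | tmul a b =>
      induction Y using TensorProduct.induction_on with
      | zero => simp
      | tmul x y =>
        simp only [LinearMap.lTensor_tmul, TensorProduct.tensorTensorTensorComm_tmul,
          TensorProduct.map_tmul, LinearMap.mul'_apply, LinearMap.comp_apply,
          hCP.conv_actUnit_mul_εt]
        simp only [actUnit_apply, inclA_apply, ← mul_assoc]
        rw [mul_assoc (f a), Algebra.TensorProduct.tmul_mul_tmul, mul_one,
          ← tmul_one_mul_comm hc]
      | add u v hu hv => simp only [TensorProduct.tmul_add, map_add, add_mul, hu, hv]
    | add u v hu hv => simp only [TensorProduct.add_tmul, map_add, mul_add, hu, hv]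
  rw [conv_twist_one hCP.pair, twist_convOne, hs, ← conv_coactCounit_actUnit_one]
  conv_lhs => enter [2, 2, 2, 3]; rw [← WH.lTensor_εt_comul_one]
  rw [key]
  rfl

theorem IsCompatiblePair.εs_comp_coactCounit (hCP : IsCompatiblePair k WH WA act coact) :
    WA.εs ∘ₗ coactCounit k WH coact = coactCounit k WH coact := by
  ext h
  exact (hCP.pair.comoduleCoalgebra.coact_counit h).symm

theorem IsCompatiblePair.twist_εs_convOne (hCP : IsCompatiblePair k WH WA act coact) :
    twist coact WA.εs (WH.convOne (A ⊗[k] H)) = inclA k H A ∘ₗ coactCounit k WH coact := by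
  rw [twist_convOne, hCP.εs_comp_coactCounit]

theorem IsCompatiblePair.twist_εs_conv (hCP : IsCompatiblePair k WH WA act coact)
    (f g : H →ₗ[k] A ⊗[k] H) :
    twist coact WA.εs (WH.conv f g) =
      WH.conv (twist coact WA.εs f) (twist coact WA.εs g) :=
  twist_conv hCP.comm hCP.pair.comoduleCoalgebra (WA.εs_mul hCP.comm) f g

theorem IsCompatiblePair.twist_εs_twist_εs (hCP : IsCompatiblePair k WH WA act coact)
    (f : H →ₗ[k] A ⊗[k] H) :
    twist coact WA.εs (twist coact WA.εs f) = twist coact WA.εs f :=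
  twist_twist hCP.pair.comoduleCoalgebra (WA.conv_εs_εs hCP.comm) f

theorem IsCompatiblePair.conv_coactCounit_twist (hCP : IsCompatiblePair k WH WA act coact)
    (f : H →ₗ[k] A ⊗[k] H) :
    WH.conv (inclA k H A ∘ₗ coactCounit k WH coact) (twist coact WA.εs f) =
      twist coact WA.εs f := by
  rw [← hCP.twist_εs_convOne, ← hCP.twist_εs_conv, WH.convOne_conv]

theorem IsCompatiblePair.conv_coactCounit_projHTwist
    (hCP : IsCompatiblePair k WH WA act coact) :
    WH.conv (inclA k H A ∘ₗ coactCounit k WH coact) (projHTwist WH WA act coact) =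
      projHTwist WH WA act coact := by
  rw [projHTwist, ← hCP.twist_εs_conv, ← WH.conv_assoc,
    ← conv_actUnit_comm hCP.comm hCP.cocomm, WH.conv_assoc, hCP.conv_coactCounit_twist]

theorem IsCompatiblePair.pairUnit_mul_self (hCP : IsCompatiblePair k WH WA act coact) :
    (pairUnit WH act coact ⊗ₜ[k] (1 : H)) * (pairUnit WH act coact ⊗ₜ[k] 1) =
      pairUnit WH act coact ⊗ₜ[k] 1 := by
  have h := hCP.conv_twist_conv_one hCP.εs_comp_coactCounit
    (twist coact WA.εs (WH.convOne (A ⊗[k] H))) (actUnit act)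
  rw [hCP.twist_εs_twist_εs, hCP.pair.moduleAlgebra.conv_actUnit, hCP.twist_εs_convOne,
    conv_coactCounit_actUnit_one] at h
  exact h.symm

theorem IsCompatiblePair.projH_one (hCP : IsCompatiblePair k WH WA act coact) :
    projH WH WA act coact 1 =
      (pairUnit WH act coact ⊗ₜ[k] 1) * WH.conv (actUnit act) (inclH k H A) 1 := by
  have h := hCP.conv_twist_conv_one hCP.εs_comp_coactCounit (inclH k H A) (actUnit act)
  rwa [hCP.pair.moduleAlgebra.conv_actUnit, ← conv_actUnit_comm hCP.comm hCP.cocomm,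
    ← conv_actUnit_comm hCP.comm hCP.cocomm] at h

theorem IsCompatiblePair.projHTwist_one (hCP : IsCompatiblePair k WH WA act coact) :
    projHTwist WH WA act coact 1 =
      (pairUnit WH act coact ⊗ₜ[k] 1) * WH.conv (actUnit act) (inclH k H A) 1 := by
  have h := hCP.conv_twist_conv_one hCP.εs_comp_coactCounit
    (WH.conv (actUnit act) (inclH k H A)) (actUnit act)
  rwa [hCP.pair.moduleAlgebra.conv_actUnit, ← conv_actUnit_comm hCP.comm hCP.cocomm,
    ← conv_actUnit_comm hCP.comm hCP.cocomm, hCP.pair.moduleAlgebra.conv_actUnit_conv,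
    hCP.twist_εs_conv] at h

theorem IsCompatiblePair.pairUnit_mul_unit_mul_projH
    (hCP : IsCompatiblePair k WH WA act coact) (h : H) :
    (pairUnit WH act coact ⊗ₜ[k] 1) *
      (WH.conv (actUnit act) (inclH k H A) 1 * projH WH WA act coact h) =
      projH WH WA act coact h := by
  rw [← mul_assoc, ← hCP.projHTwist_one, ← hCP.projH_mul, one_mul]

theorem IsCompatiblePair.pairUnit_mul_projH
    (hCP : IsCompatiblePair k WH WA act coact) (h : H) :
    (pairUnit WH act coact ⊗ₜ[k] 1) * projH WH WA act coact h =
      projH WH WA act coact h := by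
  rw [← hCP.pairUnit_mul_unit_mul_projH, ← mul_assoc, hCP.pairUnit_mul_self]

theorem extA_convOne_comp_projH (hCP : IsCompatiblePair k WH WA act coact) :
    extA (WH.convOne (A ⊗[k] H)) ∘ₗ projH WH WA act coact =
      WH.conv (actUnit act) (inclA k H A ∘ₗ coactCounit k WH coact) := by
  rw [projH, actUnit, extA_comp_conv, extA_comp_twist hCP.comm, extA_comp_inclH,
    hCP.twist_εs_convOne]

theorem extA_actUnit_comp_projH (hCP : IsCompatiblePair k WH WA act coact) :
    extA (actUnit act) ∘ₗ projH WH WA act coact =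
      WH.conv (actUnit act) (twist coact WA.εs (actUnit act)) := by
  rw [projH]
  nth_rw 2 [actUnit]
  rw [extA_comp_conv, extA_comp_twist hCP.comm, extA_comp_inclH]
  rfl

theorem IsCompatiblePair.extA_convOne_unit_mul (hCP : IsCompatiblePair k WH WA act coact)
    (b : A ⊗[k] H) :
    extA (WH.convOne (A ⊗[k] H)) (WH.conv (actUnit act) (inclH k H A) 1 * b) =
      extA (actUnit act) b := by
  have hc := hCP.comm
  have key (y : A) (g : H) (X : H ⊗[k] H) : extA (WH.convOne (A ⊗[k] H))
      (LinearMap.mul' k _ (TensorProduct.map (actUnit act) (inclH k H A) X) * (y ⊗ₜ[k] g)) =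
      (y ⊗ₜ[k] 1) * actUnit act (WH.counitMulLeft g H (TensorProduct.comm k H H X)) := by
    induction X using TensorProduct.induction_on with
    | zero => simp
    | tmul l m =>
      simp [WeakBialgebra.convOne, hc y, Algebra.algebraMap_eq_smul_one,
        Algebra.TensorProduct.one_def, TensorProduct.smul_tmul']
    | add u v hu hv => simp only [map_add, mul_add, add_mul, hu, hv]
  induction b using TensorProduct.induction_on with
  | zero => simp
  | tmul y g =>
    rw [WeakBialgebra.conv_apply, key, hCP.cocomm, ← WH.εt_eq, hCP.actUnit_εt, extA_tmul]
  | add u v hu hv => simp only [map_add, mul_add, hu, hv]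

theorem IsCompatiblePair.conv_actUnit_coactCounit_apply
    (hCP : IsCompatiblePair k WH WA act coact) (h : H) :
    WH.conv (actUnit act) (inclA k H A ∘ₗ coactCounit k WH coact) h =
      (pairUnit WH act coact ⊗ₜ[k] 1) *
        WH.conv (actUnit act) (twist coact WA.εs (actUnit act)) h := by
  rw [← extA_convOne_comp_projH hCP, LinearMap.comp_apply, ← hCP.pairUnit_mul_unit_mul_projH,
    extA_mul, hCP.extA_convOne_unit_mul, ← extA_actUnit_comp_projH hCP, LinearMap.comp_apply]

theorem IsCompatiblePair.conv_coactCounit_projH_εt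
    (hCP : IsCompatiblePair k WH WA act coact) {SH : H →ₗ[k] H} (hSH : WH.IsAntipode SH) :
    WH.conv (inclA k H A ∘ₗ coactCounit k WH coact) (projH WH WA act coact ∘ₗ WH.εt) =
      projH WH WA act coact ∘ₗ WH.εt := by
  have key (X : H ⊗[k] H) : projH WH WA act coact
      (LinearMap.mul' k H (LinearMap.lTensor H SH X)) =
      LinearMap.mul' k _ (TensorProduct.map (projHTwist WH WA act coact)
        (projH WH WA act coact ∘ₗ SH) X) := by
    induction X using TensorProduct.induction_on with
    | zero => simp
    | tmul l m => simp [hCP.projH_mul]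
    | add u v hu hv => simp only [map_add, hu, hv]
  have h1 : projH WH WA act coact ∘ₗ WH.εt =
      WH.conv (projHTwist WH WA act coact) (projH WH WA act coact ∘ₗ SH) := by
    ext h
    rw [LinearMap.comp_apply, ← hSH.mul_antipode, key, WeakBialgebra.conv_apply]
  rw [h1, ← WH.conv_assoc, hCP.conv_coactCounit_projHTwist]

theorem IsCompatiblePair.conv_coactCounit_actUnit_mul_pairUnit
    (hCP : IsCompatiblePair k WH WA act coact) {SH : H →ₗ[k] H} (hSH : WH.IsAntipode SH) (h : H) :
    WH.conv (inclA k H A ∘ₗ coactCounit k WH coact) (actUnit act) h *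
      (pairUnit WH act coact ⊗ₜ[k] 1) = actUnit act h * (pairUnit WH act coact ⊗ₜ[k] 1) := by
  have hc := hCP.comm
  have h1 : extA (WH.convOne (A ⊗[k] H)) ∘ₗ projH WH WA act coact ∘ₗ WH.εt =
      LinearMap.mulRight k (pairUnit WH act coact ⊗ₜ[k] 1) ∘ₗ actUnit act := by
    ext l
    rw [LinearMap.comp_apply, LinearMap.comp_apply, ← mul_one (WH.εt l), hCP.projH_εt_mul,
      actUnit_apply, extA_mul, ← LinearMap.comp_apply, extA_convOne_comp_projH hCP,
      conv_actUnit_comm hc hCP.cocomm, conv_coactCounit_actUnit_one]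
    rfl
  have h2 := congrArg (extA (WH.convOne (A ⊗[k] H)) ∘ₗ ·) (hCP.conv_coactCounit_projH_εt hSH)
  simp only [extA_comp_conv, h1] at h2
  have key (f g : H →ₗ[k] A ⊗[k] H) (b : A ⊗[k] H) (X : H ⊗[k] H) :
      LinearMap.mul' k _ (TensorProduct.map f (LinearMap.mulRight k b ∘ₗ g) X) =
        LinearMap.mul' k _ (TensorProduct.map f g X) * b := by
    induction X using TensorProduct.induction_on with
    | zero => simp
    | tmul a b => simp [mul_assoc]
    | add u v hu hv => simp only [map_add, add_mul, hu, hv]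
  have h3 := LinearMap.congr_fun h2 h
  rw [WeakBialgebra.conv_apply, key] at h3
  exact h3

theorem IsCompatiblePair.extA_actUnit_projH_mul_projH
    (hCP : IsCompatiblePair k WH WA act coact) {SH : H →ₗ[k] H} (hSH : WH.IsAntipode SH)
    (h t : H) :
    extA (actUnit act) (projH WH WA act coact h) * projH WH WA act coact t =
      actUnit act h * projH WH WA act coact t := by
  have hc := hCP.comm
  have hK := hCP.pairUnit_mul_projH t
  conv_rhs => rw [← hK, ← mul_assoc, ← hCP.conv_coactCounit_actUnit_mul_pairUnit hSH,
    mul_assoc, hK, ← conv_actUnit_comm hc hCP.cocomm, hCP.conv_actUnit_coactCounit_apply,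
    tmul_one_mul_comm hc, mul_assoc, hK, ← extA_actUnit_comp_projH hCP]
  rfl

theorem smashMul_tmul (x y : A) (h g : H) :
    smashMul k WH act ((x ⊗ₜ[k] h) ⊗ₜ[k] (y ⊗ₜ[k] g)) =
      (x ⊗ₜ[k] 1) * WH.conv (inclA k H A ∘ₗ act.flip y) (inclH k H A ∘ₗ LinearMap.mulRight k g) h := by
  have key : (LinearMap.rTensor H (LinearMap.mul' k A) ∘ₗ
      (TensorProduct.assoc k A A H).symm.toLinearMap ∘ₗ
      LinearMap.lTensor A (TensorProduct.map (TensorProduct.lift act) (LinearMap.mul' k H) ∘ₗ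
        (TensorProduct.tensorTensorTensorComm k H H A H).toLinearMap) ∘ₗ
      (TensorProduct.assoc k A (H ⊗[k] H) (A ⊗[k] H)).toLinearMap) ∘ₗ
      (TensorProduct.mk k (A ⊗[k] (H ⊗[k] H)) (A ⊗[k] H)).flip (y ⊗ₜ[k] g) ∘ₗ
      TensorProduct.mk k A (H ⊗[k] H) x =
      LinearMap.mulLeft k (x ⊗ₜ[k] 1) ∘ₗ LinearMap.mul' k _ ∘ₗ TensorProduct.map
        (inclA k H A ∘ₗ act.flip y) (inclH k H A ∘ₗ LinearMap.mulRight k g) := by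
    ext l m
    simp
  exact LinearMap.congr_fun key (WH.comul h)

theorem projUnder_tmul (x : A) (h : H) :
    projUnder k WH act (x ⊗ₜ[k] h) =
      (x ⊗ₜ[k] 1) * WH.conv (actUnit act) (inclH k H A) h := by
  rw [projUnder, LinearMap.comp_apply, LinearMap.flip_apply, TensorProduct.mk_apply,
    smashMul_tmul, LinearMap.mulRight_one]
  rfl

/-- The map `(a ⊗ b) ⊗ (l ⊗ c) ↦ (a ⊗ l) ⊗ (b c ⊗ m)`. -/
def comulAux (m : H) : A ⊗[k] A →ₗ[k] H ⊗[k] A →ₗ[k] (A ⊗[k] H) ⊗[k] (A ⊗[k] H) :=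
  TensorProduct.curry ((TensorProduct.assoc k (A ⊗[k] H) A H).toLinearMap ∘ₗ
    (TensorProduct.mk k ((A ⊗[k] H) ⊗[k] A) H).flip m ∘ₗ
    LinearMap.lTensor (A ⊗[k] H) (LinearMap.mul' k A) ∘ₗ
    (TensorProduct.tensorTensorTensorComm k A A H A).toLinearMap)

@[simp] theorem comulAux_tmul (m l : H) (a b c : A) :
    comulAux m (a ⊗ₜ[k] b) (l ⊗ₜ[k] c) = (a ⊗ₜ[k] l) ⊗ₜ[k] ((b * c) ⊗ₜ[k] m) := by
  simp [comulAux]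

theorem map_smashComul {B : Type*} [Ring B] [Algebra k B]
    (Q : (A ⊗[k] H) ⊗[k] (A ⊗[k] H) →ₗ[k] B) (x : A) (f g : H →ₗ[k] B)
    (hQ : ∀ l m, Q (comulAux m (WA.comul x) (coact l)) = f l * g m) (h : H) :
    Q (smashComul k WH WA coact (x ⊗ₜ[k] h)) = WH.conv f g h := by
  have key : Q ∘ₗ (TensorProduct.assoc k (A ⊗[k] H) A H).toLinearMap ∘ₗ
      LinearMap.rTensor H (LinearMap.lTensor (A ⊗[k] H) (LinearMap.mul' k A)) ∘ₗ
      LinearMap.rTensor H (TensorProduct.tensorTensorTensorComm k A A H A).toLinearMap ∘ₗ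
      (TensorProduct.assoc k (A ⊗[k] A) (H ⊗[k] A) H).symm.toLinearMap ∘ₗ
      LinearMap.lTensor (A ⊗[k] A) (LinearMap.rTensor H coact) ∘ₗ
      TensorProduct.mk k (A ⊗[k] A) (H ⊗[k] H) (WA.comul x) =
      LinearMap.mul' k B ∘ₗ TensorProduct.map f g := by
    ext l m
    exact hQ l m
  exact LinearMap.congr_fun key (WH.comul h)

theorem projBar_eq_extA (hc : ∀ a b : A, a * b = b * a) (hco : WH.Cocomm) (b : A ⊗[k] H) :
    projBar k WH WA coact b = extA (twist coact WA.εs (inclH k H A)) b := by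
  induction b using TensorProduct.induction_on with
  | zero => simp
  | tmul x h =>
    rw [projBar, ← LinearMap.comp_assoc, LinearMap.comp_apply,
      map_smashComul (f := LinearMap.mulLeft k (x ⊗ₜ[k] 1) ∘ₗ twist coact WA.εs (inclH k H A))
        (g := WH.convOne (A ⊗[k] H)), WH.conv_comm hco, WH.convOne_conv]
    · simp
    · intro a c
      simp [WeakBialgebra.convOne, Algebra.algebraMap_eq_smul_one]
    · intro l m
      rw [LinearMap.comp_apply (LinearMap.mulLeft _ _), ← εsFlip_coact]
      induction coact l using TensorProduct.induction_on with
      | zero => simp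
      | tmul a c =>
        have : (x ⊗ₜ[k] 1) * εsFlip H WA (a ⊗ₜ[k] c) =
            (WA.counitMulRight c A (WA.comul x)) ⊗ₜ[k] a := by
          simp [WA.counitMulRight_comul hc]
        rw [LinearMap.mulLeft_apply, this]
        induction WA.comul x using TensorProduct.induction_on with
        | zero => simp
        | tmul x y =>
          simp [smashCounit, hc c, WeakBialgebra.convOne, Algebra.algebraMap_eq_smul_one]
          rw [mul_comm, mul_smul, TensorProduct.smul_tmul']
        | add u v hu hv =>
          simp only [TensorProduct.add_tmul, map_add, add_mul, LinearMap.add_apply, hu, hv]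
      | add u v hu hv => simp only [map_add, add_mul, hu, hv]
  | add u v hu hv => simp only [map_add, hu, hv]

theorem projBoth_tmul (hc : ∀ a b : A, a * b = b * a) (hco : WH.Cocomm) (x : A) (h : H) :
    projBoth k WH WA act coact (x ⊗ₜ[k] h) = (x ⊗ₜ[k] 1) * projH WH WA act coact h := by
  rw [projBoth, LinearMap.comp_apply, projUnder_tmul, projBar_eq_extA hc hco, extA_mul,
    ← LinearMap.comp_apply (extA _), actUnit, extA_comp_conv, extA_comp_inclH]
  rfl

theorem IsCompatiblePair.integralWitness_eq (hCP : IsCompatiblePair k WH WA act coact) (t : H) :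
    integralWitness k WH WA act coact t = projH WH WA act coact t := by
  have hc := hCP.comm
  rw [projH, conv_actUnit_comm hc hCP.cocomm, WeakBialgebra.conv_apply, integralWitness]
  induction WH.comul t using TensorProduct.induction_on with
  | zero => simp
  | tmul a b =>
    simp only [LinearMap.lTensor_tmul, LinearMap.rTensor_tmul, TensorProduct.map_tmul,
      ← εsFlip_coact]
    induction coact a using TensorProduct.induction_on with
    | zero => simp
    | tmul l m => simp [WA.εs_mul hc, hCP.εs_act_one]
    | add u v hu hv => simp only [TensorProduct.add_tmul, map_add, hu, hv]
  | add u v hu hv => simp only [map_add, hu, hv]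

theorem IsCompatiblePair.rTensor_εs_projH (hCP : IsCompatiblePair k WH WA act coact) (h : H) :
    LinearMap.rTensor H WA.εs (projH WH WA act coact h) = projH WH WA act coact h := by
  have hc := hCP.comm
  have k1 (u v : A ⊗[k] H) : LinearMap.rTensor H WA.εs (u * v) =
      LinearMap.rTensor H WA.εs u * LinearMap.rTensor H WA.εs v := by
    induction u using TensorProduct.induction_on with
    | zero => simp
    | tmul a b =>
      induction v using TensorProduct.induction_on with
      | zero => simp
      | tmul c d => simp [WA.εs_mul hc]
      | add u v hu hv => simp only [map_add, mul_add, hu, hv]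
    | add u v hu hv => simp only [map_add, add_mul, hu, hv]
  have k2 (X : H ⊗[k] A) : LinearMap.rTensor H WA.εs (εsFlip H WA X) = εsFlip H WA X := by
    induction X using TensorProduct.induction_on with
    | zero => simp
    | tmul a b => simp [WA.εs_εs hc]
    | add u v hu hv => simp only [map_add, hu, hv]
  rw [projH, WeakBialgebra.conv_apply]
  induction WH.comul h using TensorProduct.induction_on with
  | zero => simp
  | tmul a b => simp [k1, ← εsFlip_coact, k2, hCP.εs_act_one]
  | add u v hu hv => simp only [map_add, hu, hv]

theorem IsCompatiblePair.smashMul_integral (hCP : IsCompatiblePair k WH WA act coact)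
    {α : A} {t : H} (hcond : ∀ h : H,
      (LinearMap.rTensor H (LinearMap.mulLeft k (act h α)))
          (integralWitness k WH WA act coact t) =
        (LinearMap.rTensor H
            (LinearMap.mulLeft k
              (LinearMap.mul' k A
                  ((TensorProduct.map (act.flip 1) WA.εs) (coact h)) * α)))
          (integralWitness k WH WA act coact t)) (b : A ⊗[k] H) :
    smashMul k WH act (b ⊗ₜ[k] ((α ⊗ₜ[k] 1) * projH WH WA act coact t)) =
      (α ⊗ₜ[k] 1) * extA (WH.conv (twist coact WA.εs (actUnit act)) (inclH k H A)) b *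
        projH WH WA act coact t := by
  have hc := hCP.comm
  have k0 (a : A) (w : A ⊗[k] H) :
      LinearMap.rTensor H (LinearMap.mulLeft k a) w = (a ⊗ₜ[k] 1) * w := by
    induction w using TensorProduct.induction_on with
    | zero => simp
    | tmul c l => simp
    | add u v hu hv => simp only [map_add, mul_add, hu, hv]
  have hd (h : H) : ((act h α) ⊗ₜ[k] 1) * projH WH WA act coact t =
      twist coact WA.εs (actUnit act) h * ((α ⊗ₜ[k] 1) * projH WH WA act coact t) := by
    have := hcond h
    rw [hCP.integralWitness_eq, k0, k0] at this
    rw [this, actUnit, twist_inclA, ← mul_assoc]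
    simp
  have k1 (y : A) (h : H) (v : A ⊗[k] H) :
      smashMul k WH act ((y ⊗ₜ[k] h) ⊗ₜ[k] ((α ⊗ₜ[k] 1) * LinearMap.rTensor H WA.εs v)) =
      (y ⊗ₜ[k] 1) * LinearMap.mul' k _ (TensorProduct.map (inclA k H A ∘ₗ act.flip α)
        (inclH k H A) (WH.comul h)) * LinearMap.rTensor H WA.εs v := by
    induction v using TensorProduct.induction_on with
    | zero => simp
    | tmul c l =>
      simp only [LinearMap.rTensor_tmul, Algebra.TensorProduct.tmul_mul_tmul, one_mul,
        smashMul_tmul, WeakBialgebra.conv_apply, mul_assoc (y ⊗ₜ[k] (1 : H))]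
      congr 1
      induction WH.comul h using TensorProduct.induction_on with
      | zero => simp
      | tmul m n => simp [hCP.act_mul_εs]
      | add u v hu hv => simp only [map_add, add_mul, hu, hv]
    | add u v hu hv => simp only [TensorProduct.tmul_add, map_add, mul_add, hu, hv]
  have k2 (X : H ⊗[k] H) :
      LinearMap.mul' k _ (TensorProduct.map (inclA k H A ∘ₗ act.flip α) (inclH k H A) X) *
        projH WH WA act coact t =
      (α ⊗ₜ[k] 1) * (LinearMap.mul' k _ (TensorProduct.map (twist coact WA.εs (actUnit act))
        (inclH k H A) X) * projH WH WA act coact t) := by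
    induction X using TensorProduct.induction_on with
    | zero => simp
    | tmul l m =>
      simp only [TensorProduct.map_tmul, LinearMap.mul'_apply, LinearMap.comp_apply, inclA_apply,
        LinearMap.flip_apply]
      rw [tmul_one_mul_comm hc, mul_assoc, hd, actUnit, twist_inclA, LinearMap.comp_apply,
        inclA_apply, ← mul_assoc, ← tmul_one_mul_comm hc, mul_assoc, ← mul_assoc (inclH k H A m),
        ← tmul_one_mul_comm hc α (inclH k H A m)]
      simp only [← mul_assoc]
      rw [tmul_one_mul_comm hc α]
    | add u v hu hv => simp only [map_add, mul_add, add_mul, hu, hv]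
  induction b using TensorProduct.induction_on with
  | zero => simp
  | tmul y h =>
    conv_lhs => rw [← hCP.rTensor_εs_projH, k1, hCP.rTensor_εs_projH, mul_assoc, k2]
    rw [extA_tmul, WeakBialgebra.conv_apply, ← mul_assoc, ← mul_assoc,
      tmul_one_mul_comm hc y (α ⊗ₜ[k] 1), ← mul_assoc]
  | add u v hu hv => simp only [TensorProduct.add_tmul, map_add, mul_add, add_mul, hu, hv]

theorem IsCompatiblePair.extA_conv_comp_projH (hCP : IsCompatiblePair k WH WA act coact) :
    extA (WH.conv (twist coact WA.εs (actUnit act)) (inclH k H A)) ∘ₗ projH WH WA act coact =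
      projHTwist WH WA act coact := by
  rw [projH]
  nth_rw 2 [actUnit]
  rw [extA_comp_conv, extA_comp_twist hCP.comm, extA_comp_inclH, hCP.twist_εs_conv,
    hCP.twist_εs_twist_εs]
  rfl

/-- The map `h ↦ ε(h₁ g) (h₂ · y)`. -/
def counitAct (WH : WeakBialgebra k H) (act : H →ₗ[k] A →ₗ[k] A) (y : A) (g : H) : H →ₗ[k] A :=
  WH.conv (WH.convOne A ∘ₗ LinearMap.mulRight k g) (act.flip y)

theorem smashCounit_smashMul_tmul (hco : WH.Cocomm) (x y : A) (h g : H) :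
    smashCounit k WH WA (smashMul k WH act ((x ⊗ₜ[k] h) ⊗ₜ[k] (y ⊗ₜ[k] g))) =
      WA.counit (x * counitAct WH act y g h) := by
  rw [smashMul_tmul, counitAct, WH.conv_comm hco fun a b => by
    simp, WeakBialgebra.conv_apply,
    WeakBialgebra.conv_apply]
  induction WH.comul h using TensorProduct.induction_on with
  | zero => simp
  | tmul a b => simp [smashCounit, WeakBialgebra.convOne, Algebra.algebraMap_eq_smul_one, mul_comm]
  | add u v hu hv => simp only [map_add, mul_add, hu, hv]

theorem IsCompatiblePair.smashOne_eq (hCP : IsCompatiblePair k WH WA act coact) :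
    smashOne k WH WA act coact = projH WH WA act coact 1 := by
  rw [smashOne, projBoth_tmul hCP.comm hCP.cocomm, ← Algebra.TensorProduct.one_def, one_mul]

theorem IsCompatiblePair.smashEpsT_tmul (hCP : IsCompatiblePair k WH WA act coact)
    (y : A) (g : H) :
    smashEpsT k WH WA act coact (y ⊗ₜ[k] g) =
      extA (WH.conv (twist coact LinearMap.id (inclA k H A ∘ₗ WA.εt ∘ₗ counitAct WH act y g))
        (inclH k H A)) (projH WH WA act coact 1) := by
  have hc := hCP.comm
  have k1 (b : A) (h : H) : TensorProduct.lid k (A ⊗[k] H) (LinearMap.rTensor (A ⊗[k] H)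
      (smashCounit k WH WA ∘ₗ smashMul k WH act ∘ₗ
        (TensorProduct.mk k (A ⊗[k] H) (A ⊗[k] H)).flip (y ⊗ₜ[k] g))
      (smashComul k WH WA coact (WA.εs b ⊗ₜ[k] h))) =
      extA (WH.conv (twist coact LinearMap.id (inclA k H A ∘ₗ WA.εt ∘ₗ counitAct WH act y g))
        (inclH k H A)) (WA.εs b ⊗ₜ[k] h) := by
    rw [← LinearEquiv.coe_coe, ← LinearMap.comp_apply,
      map_smashComul (f := LinearMap.mulLeft k (WA.εs b ⊗ₜ[k] 1) ∘ₗ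
        twist coact LinearMap.id (inclA k H A ∘ₗ WA.εt ∘ₗ counitAct WH act y g))
        (g := inclH k H A), extA_tmul, WeakBialgebra.conv_apply, WeakBialgebra.conv_apply]
    · induction WH.comul h using TensorProduct.induction_on with
      | zero => simp
      | tmul a b => simp [mul_assoc]
      | add u v hu hv => simp only [map_add, mul_add, hu, hv]
    · intro l m
      rw [LinearMap.comp_apply (LinearMap.mulLeft _ _), twist_apply]
      induction coact l using TensorProduct.induction_on with
      | zero => simp
      | tmul a c =>
        have : (LinearMap.mulLeft k (WA.εs b ⊗ₜ[k] (1 : H)) (LinearMap.mul' k (A ⊗[k] H)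
            (TensorProduct.map (inclA k H A ∘ₗ WA.εt ∘ₗ counitAct WH act y g)
              (inclA k H A ∘ₗ LinearMap.id) (a ⊗ₜ[k] c))) * inclH k H A m) =
            (WA.εs b * WA.εt (counitAct WH act y g a) * c) ⊗ₜ[k] m := by
          simp [mul_assoc]
        rw [this, WA.comul_εs, WA.εt_eq]
        induction WA.comul 1 using TensorProduct.induction_on with
        | zero => simp
        | tmul u v =>
          simp [smashCounit_smashMul_tmul hCP.cocomm, TensorProduct.smul_tmul', hc v]
        | add u v hu hv =>
          simp only [TensorProduct.add_tmul, map_add, add_mul, mul_add, LinearMap.add_apply, hu, hv]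
      | add u v hu hv => simp only [map_add, add_mul, hu, hv]
  rw [smashEpsT, hCP.smashOne_eq, ← hCP.rTensor_εs_projH]
  induction projH WH WA act coact 1 using TensorProduct.induction_on with
  | zero => simp
  | tmul a h => rw [LinearMap.rTensor_tmul, k1]
  | add u v hu hv => simp only [map_add, hu, hv]

theorem extA_extA (f g : H →ₗ[k] A ⊗[k] H) (u : A ⊗[k] H) :
    extA f (extA g u) = extA (extA f ∘ₗ g) u := by
  induction u using TensorProduct.induction_on with
  | zero => simp
  | tmul a h => simp [extA_mul]
  | add u v hu hv => simp only [map_add, hu, hv]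

theorem IsCompatiblePair.conv_actUnit_counitAct (hCP : IsCompatiblePair k WH WA act coact)
    (y : A) (g : H) :
    WH.conv (inclA k H A ∘ₗ counitAct WH act y g) (actUnit act) =
      inclA k H A ∘ₗ counitAct WH act y g := by
  rw [actUnit, conv_comp_inclA, counitAct, WH.conv_assoc, hCP.pair.moduleAlgebra.conv_act, mul_one]

theorem IsCompatiblePair.conv_counitAct_inclH_one (hCP : IsCompatiblePair k WH WA act coact)
    (y : A) (g : H) :
    WH.conv (inclA k H A ∘ₗ counitAct WH act y g) (inclH k H A) 1 =
      (y ⊗ₜ[k] 1) * actUnit act g * WH.conv (actUnit act) (inclH k H A) 1 := by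
  have hc := hCP.comm
  have hM := hCP.pair.moduleAlgebra
  have k1 : WH.conv (inclA k H A ∘ₗ counitAct WH act y g) (inclH k H A) 1 =
      WH.conv (inclA k H A ∘ₗ act.flip y) (inclH k H A) (WH.εt g) := by
    have h1 : inclA k H A ∘ₗ counitAct WH act y g =
        WH.conv (WH.convOne (A ⊗[k] H) ∘ₗ LinearMap.mulRight k g) (inclA k H A ∘ₗ act.flip y) := by
      have : WH.convOne (A ⊗[k] H) = inclA k H A ∘ₗ WH.convOne A := by
        ext l
        simp [WeakBialgebra.convOne, Algebra.TensorProduct.algebraMap_apply]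
      rw [this, LinearMap.comp_assoc, conv_comp_inclA, counitAct]
    have h2 (X : H ⊗[k] H) : LinearMap.mul' k _ (TensorProduct.map
        (WH.convOne (A ⊗[k] H) ∘ₗ LinearMap.mulRight k g)
        (WH.conv (inclA k H A ∘ₗ act.flip y) (inclH k H A)) X) =
        WH.conv (inclA k H A ∘ₗ act.flip y) (inclH k H A) (WH.counitMulLeft g H X) := by
      induction X using TensorProduct.induction_on with
      | zero => simp
      | tmul a b => simp [WeakBialgebra.convOne, Algebra.algebraMap_eq_smul_one]
      | add u v hu hv => simp only [map_add, hu, hv]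
    rw [h1, WH.conv_assoc, WeakBialgebra.conv_apply, h2, ← WH.εt_eq]
  have k2 (X : H ⊗[k] H) : LinearMap.mul' k _ (TensorProduct.map (inclA k H A ∘ₗ act.flip y)
      (inclH k H A) ((WH.εt g ⊗ₜ[k] 1) * X)) =
      actUnit act g * LinearMap.mul' k _ (TensorProduct.map (inclA k H A ∘ₗ act.flip y)
        (inclH k H A) X) := by
    induction X using TensorProduct.induction_on with
    | zero => simp
    | tmul a b =>
      simp [← hM.act_act, hM.act_εt hCP.cocomm, hc (act g 1)]
    | add u v hu hv => simp only [map_add, mul_add, hu, hv]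
  have k3 (X : H ⊗[k] H) : LinearMap.mul' k _ (TensorProduct.map (inclA k H A ∘ₗ act.flip y)
      (inclH k H A) (TensorProduct.comm k H H (LinearMap.lTensor H WH.εt X))) =
      (y ⊗ₜ[k] 1) * LinearMap.mul' k _ (TensorProduct.map (actUnit act) (inclH k H A)
        (TensorProduct.comm k H H X)) := by
    induction X using TensorProduct.induction_on with
    | zero => simp
    | tmul a b => simp [hM.act_εt hCP.cocomm]
    | add u v hu hv => simp only [map_add, mul_add, hu, hv]
  have k4 := k3 (WH.comul 1)
  rw [WH.lTensor_εt_comul_one, hCP.cocomm] at k4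
  rw [k1, WeakBialgebra.conv_apply, ← mul_one (WH.εt g), WH.comul_εt_mul, k2, k4, ← mul_assoc,
    actUnit_apply, tmul_one_mul_comm hc, WeakBialgebra.conv_apply]

theorem IsCompatiblePair.extA_conv_twist_projH_one (hCP : IsCompatiblePair k WH WA act coact)
    (y : A) (g : H) :
    extA (WH.conv (twist coact LinearMap.id (inclA k H A ∘ₗ counitAct WH act y g))
        (WH.conv (twist coact WA.εs (actUnit act)) (inclH k H A))) (projH WH WA act coact 1) =
      (pairUnit WH act coact ⊗ₜ[k] 1) * ((y ⊗ₜ[k] 1) * actUnit act g *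
        WH.conv (actUnit act) (inclH k H A) 1) := by
  have hc := hCP.comm
  have hco := hCP.cocomm
  have hM := hCP.pair.moduleAlgebra
  have h1 (F Z : H →ₗ[k] A ⊗[k] H) :
      WH.conv (actUnit act) (WH.conv F Z) = WH.conv F (WH.conv (actUnit act) Z) := by
    rw [← WH.conv_assoc, conv_actUnit_comm hc hco, WH.conv_assoc]
  have h2 : WH.conv (actUnit act) (inclA k H A ∘ₗ counitAct WH act y g) =
      inclA k H A ∘ₗ counitAct WH act y g := by
    rw [conv_actUnit_comm hc hco, hCP.conv_actUnit_counitAct]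
  rw [hCP.projH_one, extA_mul, ← LinearMap.comp_apply (extA _)]
  nth_rw 2 [actUnit]
  rw [extA_comp_conv, extA_comp_inclH]
  change _ * WH.conv (actUnit act) _ 1 = _
  rw [h1, hCP.conv_twist_conv_one (LinearMap.id_comp _), ← mul_assoc, hCP.pairUnit_mul_self,
    ← h1, ← WH.conv_assoc (actUnit act), h2, ← WH.conv_assoc, conv_inclA_comm hc hco,
    WH.conv_assoc, ← h2, WH.conv_assoc, hCP.conv_twist_conv_one hCP.εs_comp_coactCounit,
    ← mul_assoc, hCP.pairUnit_mul_self, hM.conv_actUnit_conv, ← WH.conv_assoc, h2,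
    hCP.conv_counitAct_inclH_one]

theorem IsCompatiblePair.smashMul_smashEpsT_integral
    (hCP : IsCompatiblePair k WH WA act coact) {α : A} {t : H} (hα : WA.IsLeftIntegral α)
    (hcond : ∀ h : H,
      (LinearMap.rTensor H (LinearMap.mulLeft k (act h α)))
          (integralWitness k WH WA act coact t) =
        (LinearMap.rTensor H
            (LinearMap.mulLeft k
              (LinearMap.mul' k A
                  ((TensorProduct.map (act.flip 1) WA.εs) (coact h)) * α)))
          (integralWitness k WH WA act coact t)) (u : A ⊗[k] H) :
    smashMul k WH act (smashEpsT k WH WA act coact u ⊗ₜ[k]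
      ((α ⊗ₜ[k] 1) * projH WH WA act coact t)) =
      (α ⊗ₜ[k] 1) * extA (actUnit act) u * projH WH WA act coact t := by
  have hc := hCP.comm
  have k1 (f : H →ₗ[k] A) (h : H) :
      (α ⊗ₜ[k] (1 : H)) * twist coact LinearMap.id (inclA k H A ∘ₗ WA.εt ∘ₗ f) h =
        (α ⊗ₜ[k] 1) * twist coact LinearMap.id (inclA k H A ∘ₗ f) h := by
    simp only [twist_apply]
    induction coact h using TensorProduct.induction_on with
    | zero => simp
    | tmul a c =>
      have : α * (WA.εt (f a) * c) = α * (f a * c) := by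
        rw [← mul_assoc, hc α, ← hα, hc _ α, mul_assoc]
      simp [this]
    | add u v hu hv => simp only [map_add, mul_add, hu, hv]
  have k2 (f : H →ₗ[k] A) (Z : H →ₗ[k] A ⊗[k] H) (h : H) :
      (α ⊗ₜ[k] (1 : H)) * WH.conv (twist coact LinearMap.id (inclA k H A ∘ₗ WA.εt ∘ₗ f)) Z h =
        (α ⊗ₜ[k] 1) * WH.conv (twist coact LinearMap.id (inclA k H A ∘ₗ f)) Z h := by
    simp only [WeakBialgebra.conv_apply]
    induction WH.comul h using TensorProduct.induction_on with
    | zero => simp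
    | tmul a c => simp only [TensorProduct.map_tmul, LinearMap.mul'_apply, ← mul_assoc, k1]
    | add u v hu hv => simp only [map_add, mul_add, hu, hv]
  have k3 (f : H →ₗ[k] A) (Z : H →ₗ[k] A ⊗[k] H) (v : A ⊗[k] H) :
      (α ⊗ₜ[k] (1 : H)) *
        extA (WH.conv (twist coact LinearMap.id (inclA k H A ∘ₗ WA.εt ∘ₗ f)) Z) v =
        (α ⊗ₜ[k] 1) * extA (WH.conv (twist coact LinearMap.id (inclA k H A ∘ₗ f)) Z) v := by
    induction v using TensorProduct.induction_on with
    | zero => simp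
    | tmul a c =>
      rw [extA_tmul, extA_tmul, ← mul_assoc, ← mul_assoc, tmul_one_mul_comm hc α, mul_assoc, k2,
        mul_assoc]
    | add u v hu hv => simp only [map_add, mul_add, hu, hv]
  induction u using TensorProduct.induction_on with
  | zero => simp [smashEpsT]
  | tmul y g =>
    rw [hCP.smashMul_integral hcond, hCP.smashEpsT_tmul, extA_extA, twist_inclA, extA_comp_conv,
      extA_comp_inclH, ← twist_inclA, k3, hCP.extA_conv_twist_projH_one, extA_tmul]
    have := hCP.pairUnit_mul_unit_mul_projH t
    rw [← mul_assoc (pairUnit WH act coact ⊗ₜ[k] 1), ← mul_assoc, tmul_one_mul_comm hc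
      (pairUnit WH act coact), mul_assoc, mul_assoc, mul_assoc, this, ← mul_assoc]
  | add u v hu hv =>
    have : smashEpsT k WH WA act coact (u + v) =
        smashEpsT k WH WA act coact u + smashEpsT k WH WA act coact v := by
      simp only [smashEpsT, map_add, LinearMap.comp_add, LinearMap.rTensor_add,
        LinearMap.add_apply]
    rw [this, TensorProduct.add_tmul, map_add, hu, hv, map_add, mul_add, add_mul]

end MatchedPairLemmas

theorem smash_leftIntegral
    {k H A : Type*} [Field k] [Ring H] [Algebra k H] [Ring A] [Algebra k A]
    (WH : WeakBialgebra k H) (WA : WeakBialgebra k A)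
    (act : H →ₗ[k] A →ₗ[k] A) (coact : H →ₗ[k] H ⊗[k] A)
    (SH : H →ₗ[k] H) (SA : A →ₗ[k] A)
    (hCP : IsCompatiblePair k WH WA act coact)
    (hSH : WH.IsAntipode SH) (hSA : WA.IsAntipode SA)
    (h7 : ∀ h : H, cond7LHS k WH WA act coact SA h = cond7RHS k WH WA act coact h)
    (h8 : ∀ h : H, cond8LHS k WH WA act coact SH h = cond8RHS k WH WA act coact h)
    (α : A) (t : H) (hα : WA.IsLeftIntegral α) (ht : WH.IsLeftIntegral t)
    (hcond : ∀ h : H,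
      (LinearMap.rTensor H (LinearMap.mulLeft k (act h α)))
          (integralWitness k WH WA act coact t) =
        (LinearMap.rTensor H
            (LinearMap.mulLeft k
              (LinearMap.mul' k A
                  ((TensorProduct.map (act.flip 1) WA.εs) (coact h)) * α)))
          (integralWitness k WH WA act coact t)) :
    ∀ (x : A) (h : H),
      smashMul k WH act
          (projBoth k WH WA act coact (x ⊗ₜ[k] h) ⊗ₜ[k]
            projBoth k WH WA act coact (α ⊗ₜ[k] t)) =
        smashMul k WH act
          (smashEpsT k WH WA act coact (projBoth k WH WA act coact (x ⊗ₜ[k] h)) ⊗ₜ[k]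
            projBoth k WH WA act coact (α ⊗ₜ[k] t)) := by
  intro x h
  have e (u v w z : A ⊗[k] H) (h : z * v = w * v) : u * z * v = u * w * v := by
    rw [mul_assoc, h, mul_assoc]
  rw [projBoth_tmul hCP.comm hCP.cocomm, projBoth_tmul hCP.comm hCP.cocomm,
    hCP.smashMul_integral hcond, hCP.smashMul_smashEpsT_integral hα hcond, extA_mul, extA_mul,
    ← LinearMap.comp_apply (extA _), hCP.extA_conv_comp_projH]
  apply e
  rw [mul_assoc, mul_assoc, hCP.extA_actUnit_projH_mul_projH hSH, ← hCP.projH_mul, ht h,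
    hCP.projH_εt_mul]

end WeakSmash
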